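/- arXiv:2301.10131 — 2 statements merged into one kernel-verified Lean document; each statement's English description precedes it below -/
import Mathlib

section
/- For every integer r ≥ 3 and every ε > 0 there exists n₀ ∈ ℕ such that for every even n ≥ n₀ divisible by r, the complete multipartite graph G = K_{r×(n/r)} (r parts, each of size n/r) and any perfect matching N of G satisfy (1−ε)·e^{−r/(2(r−1))} ≤ pm(G−N)/pm(G) ≤ (1+ε)·e^{−r/(2(r−1))}, where pm(H) denotes the number of perfect matchings of a graph H and G−N is G with the edges of N removed. -/
open Finset

namespace RPM

/-- The `ν`-robust neighbourhood of a vertex set `S` in a graph `G` on `n` vertices: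
all vertices having at least `ν * n` neighbours in `S`. -/
def RN {V : Type*} [Fintype V] (G : SimpleGraph V) (ν : ℝ) (S : Set V) : Set V :=
  {v : V | ν * (Fintype.card V : ℝ) ≤ (Nat.card {u : V | u ∈ S ∧ G.Adj v u} : ℝ)}

/-- `G` is a robust `(ν, τ)`-expander. -/
def RobustExpander {V : Type*} [Fintype V] (G : SimpleGraph V) (ν τ : ℝ) : Prop :=
  ∀ S : Set V,
    τ * (Fintype.card V : ℝ) ≤ (Nat.card S : ℝ) →
    (Nat.card S : ℝ) ≤ (1 - τ) * (Fintype.card V : ℝ) →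
    (Nat.card S : ℝ) + ν * (Fintype.card V : ℝ) ≤ (Nat.card (RN G ν S) : ℝ)

/-- `M` (a set of edges) is a perfect matching of `G`: its edges are edges of `G`,
and every vertex lies in exactly one edge of `M` (in particular the edges are
pairwise disjoint and cover all vertices). -/
def IsPM {V : Type*} (G : SimpleGraph V) (M : Finset (Sym2 V)) : Prop :=
  (∀ e ∈ M, e ∈ G.edgeSet) ∧ ∀ v : V, ∃! e, e ∈ M ∧ v ∈ e

/-- The number of perfect matchings of `G`. -/
noncomputable def pmCount {V : Type*} (G : SimpleGraph V) : ℕ :=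
  Nat.card {M : Finset (Sym2 V) // IsPM G M}

/-- `N` (a set of edges) is a matching in `G`: edges of `G`, pairwise disjoint. -/
def IsMatchingIn {V : Type*} (G : SimpleGraph V) (N : Finset (Sym2 V)) : Prop :=
  (∀ e ∈ N, e ∈ G.edgeSet) ∧ ∀ e ∈ N, ∀ f ∈ N, e ≠ f → ∀ v : V, v ∈ e → v ∉ f

/-- `G` is `d`-regular: every vertex has exactly `d` neighbours. -/
def RegularDeg {V : Type*} (G : SimpleGraph V) (d : ℕ) : Prop :=
  ∀ v : V, Nat.card {u : V | G.Adj v u} = d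

/-- Probability that a uniformly random perfect matching of `G` contains the edge `e`. -/
noncomputable def edgeProb {V : Type*} (G : SimpleGraph V) (e : Sym2 V) : ℝ :=
  (Nat.card {M : Finset (Sym2 V) // IsPM G M ∧ e ∈ M} : ℝ) / (pmCount G : ℝ)

/-- `P[X = k]` where `X = |M ∩ N|` for a uniformly random perfect matching `M` of `G`. -/
noncomputable def interProb {V : Type*} [DecidableEq V] (G : SimpleGraph V)
    (N : Finset (Sym2 V)) (k : ℕ) : ℝ :=
  (Nat.card {M : Finset (Sym2 V) // IsPM G M ∧ (M ∩ N).card = k} : ℝ) / (pmCount G : ℝ)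

/-- The Poisson probability mass function with parameter `lam`. -/
noncomputable def poissonPMF (lam : ℝ) (k : ℕ) : ℝ :=
  Real.exp (-lam) * lam ^ k / (Nat.factorial k)

section recursion
variable {V ι : Type*} [DecidableEq V] [DecidableEq ι] {p : V → ι} {F : Finset V → ℝ}

/-- The defining recursion of perfect matching counts of complete multipartite graphs
with parts given by the fibres of `p`. -/
def MatchingRecursion (p : V → ι) (F : Finset V → ℝ) : Prop :=
  ∀ W : Finset V, ∀ v ∉ W, F (insert v W) = ∑ w ∈ W with p w ≠ p v, F (W.erase w)

theorem MatchingRecursion.insert_eq (hF : MatchingRecursion p F) {W : Finset V} {u v : V}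
    (hu : u ∉ W) (hv : v ∉ W) (h : p u = p v) : F (insert u W) = F (insert v W) := by
  rw [hF W u hu, hF W v hv, h]

theorem insert_erase_erase {W : Finset V} {x y : V} (hx : x ∈ W) (hxy : x ≠ y) :
    insert x ((W.erase x).erase y) = W.erase y := by
  rw [erase_right_comm, insert_erase (mem_erase.2 ⟨hxy, hx⟩)]

theorem MatchingRecursion.erase_eq (hF : MatchingRecursion p F) {W : Finset V} {x y : V}
    (hx : x ∈ W) (hy : y ∈ W) (h : p x = p y) : F (W.erase x) = F (W.erase y) := by
  rcases eq_or_ne x y with rfl | hxy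
  · rfl
  · have h1 : insert y ((W.erase x).erase y) = W.erase x := insert_erase (mem_erase.2 ⟨hxy.symm, hy⟩)
    have h2 := insert_erase_erase hx hxy
    generalize hU : (W.erase x).erase y = U at *
    rw [← h1, ← h2]
    subst hU
    exact hF.insert_eq (W := (W.erase x).erase y) (by simp) (by simp) h.symm

theorem MatchingRecursion.sum_part (hF : MatchingRecursion p F) {W : Finset V} {x : V}
    (hx : x ∈ W) :
    ∑ w ∈ W with p w = p x, F (W.erase w) = #{w ∈ W | p w = p x} * F (W.erase x) := by
  rw [sum_congr rfl (g := fun _ => F (W.erase x)), sum_const, nsmul_eq_mul]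
  intro w hw
  rw [mem_filter] at hw
  exact hF.erase_eq hw.1 hx hw.2

/-- The contribution to both sides that is common to two vertices in parts `i` and `j`. -/
theorem MatchingRecursion.insert_eq_add (hF : MatchingRecursion p F) {W : Finset V} {u v : V}
    (hu : u ∉ W) (h : p u ≠ p v) :
    F (insert u W) = ∑ w ∈ W with p w = p v, F (W.erase w) +
      ∑ w ∈ W with p w ≠ p u ∧ p w ≠ p v, F (W.erase w) := by
  rw [hF W u hu, ← sum_filter_add_sum_filter_not (s := {w ∈ W | p w ≠ p u}) (p := fun w => p w = p v),
    filter_filter, filter_filter]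
  congr 2
  ext w
  simp only [mem_filter]
  constructor
  · tauto
  · rintro ⟨h1, h2⟩
    exact ⟨h1, h2 ▸ h.symm, h2⟩

theorem card_part_erase_erase {W : Finset V} {x y : V} (hx : x ∈ W) (h : p x ≠ p y) :
    #{w ∈ (W.erase x).erase y | p w = p x} + 1 = #{w ∈ W | p w = p x} := by
  have : {w ∈ (W.erase x).erase y | p w = p x} = {w ∈ W | p w = p x}.erase x := by
    ext w
    simp only [mem_filter, mem_erase]
    constructor
    · tauto
    · rintro ⟨h1, h2, h3⟩
      refine ⟨⟨?_, h1, h2⟩, h3⟩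
      rintro rfl
      exact h h3.symm
  rw [this, card_erase_add_one]
  simp [hx]

theorem card_part_erase_erase_of_ne {W : Finset V} {x y : V} {l : ι} (hx : l ≠ p x) (hy : l ≠ p y) :
    #{w ∈ (W.erase x).erase y | p w = l} = #{w ∈ W | p w = l} := by
  congr 1
  ext w
  simp only [mem_filter, mem_erase]
  constructor
  · tauto
  · rintro ⟨h1, h2⟩
    refine ⟨⟨?_, ?_, h1⟩, h2⟩ <;> rintro rfl <;> tauto

omit [DecidableEq V] in
theorem exists_mem_part {W : Finset V} {i : ι} (h : #{w ∈ W | p w = i} ≠ 0) :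
    ∃ x ∈ W, p x = i := by
  obtain ⟨x, hx⟩ := card_ne_zero.1 h
  exact ⟨x, (mem_filter.1 hx).1, (mem_filter.1 hx).2⟩

/-- Balancing the parts increases the count. -/
theorem MatchingRecursion.insert_le (hF : MatchingRecursion p F) (h0 : ∀ W, 0 ≤ F W)
    {W : Finset V} {u v : V} (hu : u ∉ W) (hv : v ∉ W)
    (h : #{w ∈ W | p w = p v} ≤ #{w ∈ W | p w = p u}) :
    F (insert u W) ≤ F (insert v W) := by
  induction hn : #W using Nat.strong_induction_on generalizing W u v with
  | _ n ih =>
  by_cases huv : p u = p v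
  · exact (hF.insert_eq hu hv huv).le
  rw [hF.insert_eq_add hu huv, hF.insert_eq_add hv (Ne.symm huv)]
  simp only [and_comm (a := p _ ≠ p v)]
  gcongr ?_ + _
  by_cases hc : #{w ∈ W | p w = p v} = 0
  · rw [card_eq_zero.1 hc, sum_empty]
    exact sum_nonneg fun _ _ => h0 _
  obtain ⟨y, hy, hyv⟩ := exists_mem_part hc
  obtain ⟨x, hx, hxu⟩ := exists_mem_part (p := p) (W := W) (i := p u) (by omega)
  rw [← hyv, ← hxu, hF.sum_part hy, hF.sum_part hx]
  rw [← hyv, ← hxu] at h huv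
  have hxy : x ≠ y := fun e => huv (e ▸ rfl)
  have h1 := card_part_erase_erase hx huv
  have h2 := card_part_erase_erase hy (Ne.symm huv)
  rw [erase_right_comm] at h2
  have := ih #((W.erase x).erase y) (by
    rw [card_erase_of_mem (mem_erase.2 ⟨hxy.symm, hy⟩), card_erase_of_mem hx]
    have := card_pos.2 ⟨x, hx⟩
    omega) (W := (W.erase x).erase y) (u := x) (v := y) (by simp) (by simp) (by omega) rfl
  rw [insert_erase_erase hx hxy, erase_right_comm, insert_erase_erase hy hxy.symm] at this
  gcongr
  exact h0 _

theorem MatchingRecursion.erase_le (hF : MatchingRecursion p F) (h0 : ∀ W, 0 ≤ F W)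
    {W : Finset V} {x y : V} (hx : x ∈ W) (hy : y ∈ W)
    (h : #{w ∈ W | p w = p x} ≤ #{w ∈ W | p w = p y}) :
    F (W.erase x) ≤ F (W.erase y) := by
  by_cases hxy : p x = p y
  · exact (hF.erase_eq hx hy hxy).le
  have hne : x ≠ y := fun e => hxy (e ▸ rfl)
  have h1 := card_part_erase_erase hx hxy
  have h2 := card_part_erase_erase hy (Ne.symm hxy)
  rw [erase_right_comm] at h2
  have h3 : insert y ((W.erase x).erase y) = W.erase x := insert_erase (mem_erase.2 ⟨hne.symm, hy⟩)
  have h4 := insert_erase_erase hx hne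
  generalize hU : (W.erase x).erase y = U at *
  rw [← h3, ← h4]
  subst hU
  exact hF.insert_le h0 (W := (W.erase x).erase y) (by simp) (by simp) (by omega)

theorem MatchingRecursion.sum_part_le (hF : MatchingRecursion p F) (h0 : ∀ W, 0 ≤ F W)
    {W : Finset V} {i l : ι} (h : #{w ∈ W | p w = i} ≤ #{w ∈ W | p w = l}) :
    ∑ w ∈ W with p w = i, F (W.erase w) ≤ ∑ w ∈ W with p w = l, F (W.erase w) := by
  by_cases hc : #{w ∈ W | p w = i} = 0
  · rw [card_eq_zero.1 hc, sum_empty]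
    exact sum_nonneg fun _ _ => h0 _
  obtain ⟨x, hx, rfl⟩ := exists_mem_part hc
  obtain ⟨y, hy, rfl⟩ := exists_mem_part (p := p) (W := W) (i := l) (by omega)
  rw [hF.sum_part hx, hF.sum_part hy]
  have := hF.erase_le h0 hx hy h
  gcongr
  exact h0 _

theorem MatchingRecursion.part_add_part_le (hF : MatchingRecursion p F) (h0 : ∀ W, 0 ≤ F W)
    {W : Finset V} {u v : V} (hu : u ∉ W) (huv : p u ≠ p v) {l : ι}
    (hlu : l ≠ p u) (hlv : l ≠ p v) :
    ∑ w ∈ W with p w = p v, F (W.erase w) + ∑ w ∈ W with p w = l, F (W.erase w) ≤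
      F (insert u W) := by
  rw [hF.insert_eq_add hu huv]
  refine add_le_add le_rfl (sum_le_sum_of_subset_of_nonneg ?_ ?_)
  · intro w
    simp only [mem_filter]
    rintro ⟨h1, rfl⟩
    exact ⟨h1, hlu, hlv⟩
  · exact fun _ _ _ => h0 _

theorem MatchingRecursion.insert_sub_insert (hF : MatchingRecursion p F) {W : Finset V} {u v : V}
    (hu : u ∉ W) (hv : v ∉ W) (h : p u ≠ p v) :
    F (insert v W) - F (insert u W) = ∑ w ∈ W with p w = p u, F (W.erase w) -
      ∑ w ∈ W with p w = p v, F (W.erase w) := by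
  rw [hF.insert_eq_add hu h, hF.insert_eq_add hv h.symm]
  simp only [and_comm (a := p _ ≠ p v)]
  ring

theorem MatchingRecursion.insert_le_two_mul (hF : MatchingRecursion p F) (h0 : ∀ W, 0 ≤ F W)
    {W : Finset V} {u v : V} (hu : u ∉ W) (hv : v ∉ W) (huv : p u ≠ p v) {l : ι}
    (hlu : l ≠ p u) (hlv : l ≠ p v)
    (hl : #{w ∈ W | p w = p u} ≤ #{w ∈ W | p w = l}) :
    F (insert v W) ≤ 2 * F (insert u W) := by
  have h1 := hF.insert_sub_insert hu hv huv
  have h2 := hF.sum_part_le h0 hl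
  have h3 := hF.part_add_part_le h0 hu huv hlu hlv
  have h4 : 0 ≤ ∑ w ∈ W with p w = p v, F (W.erase w) := sum_nonneg fun _ _ => h0 _
  linarith

/-- If a third part is at least as large as the two considered, then the counts are close. -/
theorem MatchingRecursion.sub_mul_le (hF : MatchingRecursion p F) (h0 : ∀ W, 0 ≤ F W)
    {W : Finset V} {u v : V} (hu : u ∉ W) (hv : v ∉ W) (huv : p u ≠ p v) {l : ι}
    (hlu : l ≠ p u) (hlv : l ≠ p v) {s a : ℕ}
    (hs : #{w ∈ W | p w = p v} = s) (ha : #{w ∈ W | p w = p u} = s + a)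
    (hl : s + a ≤ #{w ∈ W | p w = l}) :
    (F (insert v W) - F (insert u W)) * (s + 1) ≤ 3 * a * F (insert u W) := by
  have hFu := h0 (insert u W)
  have hdiff := hF.insert_le_two_mul h0 hu hv huv hlu hlv (by omega)
  rcases Nat.eq_zero_or_pos a with rfl | ha0
  · have := hF.insert_le h0 hv hu (by omega)
    have hs0 : (0 : ℝ) ≤ s := Nat.cast_nonneg _
    simp only [Nat.cast_zero]
    nlinarith
  induction s generalizing W u v with
  | zero =>
    have : (1 : ℝ) ≤ a := by exact_mod_cast ha0
    push_cast
    nlinarith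
  | succ s ih =>
    by_cases hsa : s ≤ a
    · have h1 : (1 : ℝ) ≤ a := by exact_mod_cast ha0
      have h2 : (s : ℝ) ≤ a := by exact_mod_cast hsa
      push_cast
      calc _ ≤ F (insert u W) * (s + 1 + 1) := by gcongr; linarith
        _ ≤ F (insert u W) * (3 * a) := by gcongr; linarith
        _ = _ := by ring
    push Not at hsa
    obtain ⟨y, hy, hyv⟩ := exists_mem_part (p := p) (W := W) (i := p v) (by omega)
    obtain ⟨x, hx, hxu⟩ := exists_mem_part (p := p) (W := W) (i := p u) (by omega)
    obtain ⟨z, hz, rfl⟩ := exists_mem_part (p := p) (W := W) (i := l) (by omega)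
    have e1 := hF.insert_sub_insert hu hv huv
    have e2 := hF.part_add_part_le h0 hu huv hlu hlv
    have e3 := hF.erase_le h0 hy hz (by rw [hyv]; omega)
    rw [← hyv] at hs e1 e2 huv hlv
    rw [← hxu] at ha e1 huv hlu
    have hxy : x ≠ y := fun e => huv (e ▸ rfl)
    have h1 := card_part_erase_erase hx huv
    have h2 := card_part_erase_erase hy (Ne.symm huv)
    rw [erase_right_comm] at h2
    have h3 := card_part_erase_erase_of_ne (W := W) hlu hlv
    have := ih (W := (W.erase x).erase y) (u := x) (v := y) (by simp) (by simp) huv hlu hlv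
      (by omega) (by omega) (by omega) (h0 _)
      (hF.insert_le_two_mul h0 (by simp) (by simp) huv hlu hlv (by omega))
    rw [insert_erase_erase hx hxy, erase_right_comm, insert_erase_erase hy hxy.symm] at this
    rw [hF.sum_part hy, hs] at e1 e2
    rw [hF.sum_part hx, ha] at e1
    rw [hF.sum_part hz] at e2
    rw [e1]
    have hl' : (s + 1 + a : ℝ) ≤ #{w ∈ W | p w = p z} := by exact_mod_cast hl
    have e4 : ((s : ℝ) + 1 + (s + 1 + a)) * F (W.erase y) ≤ F (insert u W) := by
      refine le_trans ?_ e2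
      push_cast
      rw [add_mul]
      gcongr
      exact h0 _
    have hyF := h0 (W.erase y)
    generalize F (W.erase x) = X at *
    generalize F (W.erase y) = Y at *
    generalize F (insert u W) = U at *
    have hs1 : (a : ℝ) + 1 ≤ s := by exact_mod_cast hsa
    have ha1 : (1 : ℝ) ≤ a := by exact_mod_cast ha0
    push_cast
    generalize (s : ℝ) = t at *
    generalize (a : ℝ) = b at *
    have ht : 0 ≤ t := by linarith
    have e5 : (t + 1 + 1) * (t + 1 + b) * ((X - Y) * (t + 1)) ≤
        (t + 1 + 1) * (t + 1 + b) * (3 * b * Y) := by gcongr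
    have e6 : 3 * b * (t + 1) * ((t + 1 + (t + 1 + b)) * Y) ≤ 3 * b * (t + 1) * U := by gcongr
    have e7 : 0 ≤ b * Y * (2 * (t + 1) ^ 2 - 4 * (t + 1) - 3 * b) := by
      have : 0 ≤ 2 * (t + 1) ^ 2 - 4 * (t + 1) - 3 * b := by nlinarith
      positivity
    refine le_of_mul_le_mul_left (a := t + 1) ?_ (by linarith)
    nlinarith

/-- Two counts of nearly balanced vertex sets that differ in one vertex are close. -/
theorem MatchingRecursion.insert_le_mul (hF : MatchingRecursion p F) (h0 : ∀ W, 0 ≤ F W)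
    {W : Finset V} {u v : V} (hu : u ∉ W) (hv : v ∉ W) (huv : p u ≠ p v) {l : ι}
    (hlu : l ≠ p u) (hlv : l ≠ p v) {q a t : ℕ} (hq : 0 < q)
    (hs : #{w ∈ W | p w = p v} = q + t) (ha : #{w ∈ W | p w = p u} = q + t + a)
    (hl : q + a ≤ #{w ∈ W | p w = l}) :
    F (insert v W) ≤ (1 + 3 * a / q) ^ (t + 1) * F (insert u W) := by
  have hq' : (0 : ℝ) < q := by exact_mod_cast hq
  induction t generalizing W u v with
  | zero =>
    have h := hF.sub_mul_le h0 hu hv huv hlu hlv hs ha (by omega)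
    have hU := h0 (insert u W)
    have hmono := hF.insert_le h0 hu hv (by omega)
    rw [zero_add, pow_one, add_mul, div_mul_eq_mul_div, one_mul, ← sub_le_iff_le_add',
      le_div_iff₀ hq']
    push_cast at h
    nlinarith
  | succ t ih =>
    obtain ⟨y, hy, hyv⟩ := exists_mem_part (p := p) (W := W) (i := p v) (by omega)
    obtain ⟨x, hx, hxu⟩ := exists_mem_part (p := p) (W := W) (i := p u) (by omega)
    have e1 := hF.insert_eq_add hu huv
    have e2 := hF.insert_eq_add hv huv.symm
    simp only [and_comm (a := p _ ≠ p v)] at e2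
    have e3 : 0 ≤ ∑ w ∈ W with p w ≠ p u ∧ p w ≠ p v, F (W.erase w) :=
      sum_nonneg fun _ _ => h0 _
    generalize ∑ w ∈ W with p w ≠ p u ∧ p w ≠ p v, F (W.erase w) = S at *
    rw [← hyv] at hs e1 huv hlv
    rw [← hxu] at ha e2 huv hlu
    have hxy : x ≠ y := fun e => huv (e ▸ rfl)
    have h1 := card_part_erase_erase hx huv
    have h2 := card_part_erase_erase hy (Ne.symm huv)
    rw [erase_right_comm] at h2
    have h3 := card_part_erase_erase_of_ne (W := W) hlu hlv
    have := ih (W := (W.erase x).erase y) (u := x) (v := y) (by simp) (by simp) huv hlu hlv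
      (by omega) (by omega) (by omega)
    rw [insert_erase_erase hx hxy, erase_right_comm, insert_erase_erase hy hxy.symm] at this
    rw [hF.sum_part hy, hs] at e1
    rw [hF.sum_part hx, ha] at e2
    rw [e1, e2]
    have hyF := h0 (W.erase y)
    have hb : (0 : ℝ) ≤ 3 * a / q := by positivity
    have hR : (1 : ℝ) ≤ (1 + 3 * a / q) ^ (t + 1 + 1) := one_le_pow₀ (by linarith)
    have hc : ((q + (t + 1) + a : ℕ) : ℝ) ≤ (1 + 3 * a / q) * (q + (t + 1) : ℕ) := by
      push_cast
      have : (3 * a / q : ℝ) * q = 3 * a := by field_simp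
      have h4 : (0 : ℝ) ≤ 3 * a / q * (t + 1) := by positivity
      have h5 : (0 : ℝ) ≤ a := by positivity
      nlinarith
    calc _ ≤ (1 + 3 * a / q) * (q + (t + 1) : ℕ) * ((1 + 3 * a / q) ^ (t + 1) * F (W.erase y))
            + (1 + 3 * a / q) ^ (t + 1 + 1) * S := by
          refine add_le_add ?_ (le_mul_of_one_le_left e3 hR)
          gcongr
          exact h0 _
      _ = _ := by ring

end recursion
section ratio
variable {V ι : Type*} [DecidableEq V] [Fintype V] [DecidableEq ι] [Fintype ι]
  {p : V → ι} {F : Finset V → ℝ} {m C : ℕ}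

omit [Fintype ι] in
theorem le_card_part_add (hm : ∀ i, #{w | p w = i} = m) {U : Finset V}
    (hU : Fintype.card V ≤ #U + C) (i : ι) : m ≤ #{w ∈ U | p w = i} + C := by
  have h1 : ({w | p w = i} : Finset V) ⊆ {w ∈ U | p w = i} ∪ Uᶜ := by
    intro w
    simp only [mem_filter, mem_union, mem_compl, mem_univ, true_and]
    tauto
  have h2 := (card_le_card h1).trans (card_union_le _ _)
  rw [hm, card_compl] at h2
  omega

omit [DecidableEq V] [Fintype ι] in
theorem card_part_le (hm : ∀ i, #{w | p w = i} = m) (U : Finset V) (i : ι) :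
    #{w ∈ U | p w = i} ≤ m :=
  (hm i) ▸ card_le_card (filter_subset_filter _ (subset_univ _))

/-- An upper bound for the ratio of the counts of two vertex sets differing in one vertex. -/
noncomputable def ratioBound (C m : ℕ) : ℝ := (1 + 3 * C / (m - 2 * C : ℕ)) ^ (C + 1)

theorem one_le_ratioBound (C m : ℕ) : 1 ≤ ratioBound C m := by
  apply one_le_pow₀
  have : (0 : ℝ) ≤ 3 * C / (m - 2 * C : ℕ) := by positivity
  linarith

theorem MatchingRecursion.erase_le_mul (hF : MatchingRecursion p F) (h0 : ∀ W, 0 ≤ F W)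
    (hι : 3 ≤ Fintype.card ι) (hm : ∀ i, #{w | p w = i} = m) (hC : 2 * C < m)
    {W : Finset V} (hW : Fintype.card V + 2 ≤ #W + C) {x y : V} (hx : x ∈ W) (hy : y ∈ W) :
    F (W.erase x) ≤ ratioBound C m * F (W.erase y) := by
  have h1 := one_le_ratioBound C m
  by_cases hxy : p x = p y
  · rw [hF.erase_eq hx hy hxy]
    exact le_mul_of_one_le_left (h0 _) h1
  have hne : x ≠ y := fun e => hxy (e ▸ rfl)
  have h3 : insert y ((W.erase x).erase y) = W.erase x := insert_erase (mem_erase.2 ⟨hne.symm, hy⟩)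
  have h4 := insert_erase_erase hx hne
  have hU : Fintype.card V ≤ #((W.erase x).erase y) + C := by
    rw [card_erase_of_mem (mem_erase.2 ⟨hne.symm, hy⟩), card_erase_of_mem hx]
    omega
  have hxU : x ∉ (W.erase x).erase y := by simp
  have hyU : y ∉ (W.erase x).erase y := by simp
  generalize hU' : (W.erase x).erase y = U at *
  rw [← h3, ← h4]
  rcases le_total #{w ∈ U | p w = p y} #{w ∈ U | p w = p x} with h | h
  · obtain ⟨l, hl⟩ : ∃ l, l ∉ ({p x, p y} : Finset ι) := by
      by_contra! hcon
      have := (card_le_card fun i _ => hcon i : #(univ : Finset ι) ≤ _).trans card_le_two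
      rw [card_univ] at this
      omega
    simp only [mem_insert, mem_singleton, not_or] at hl
    have a1 := le_card_part_add hm hU (p y)
    have a2 := le_card_part_add hm hU l
    have a3 := card_part_le hm U (p x)
    obtain ⟨a, ha⟩ := Nat.exists_eq_add_of_le h
    obtain ⟨q, hq⟩ := Nat.exists_eq_add_of_le (show C ≤ #{w ∈ U | p w = p y} by omega)
    refine (hF.insert_le_mul h0 hxU hyU hxy hl.1 hl.2 (q := q) (a := a) (t := C) (by omega)
      (by omega) (by omega) (by omega)).trans ?_
    refine mul_le_mul_of_nonneg_right ?_ (h0 _)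
    have b1 : (0 : ℝ) < (m - 2 * C : ℕ) := by exact_mod_cast (by omega)
    have b2 : ((m - 2 * C : ℕ) : ℝ) ≤ q := by exact_mod_cast (by omega)
    have b3 : (a : ℝ) ≤ C := by exact_mod_cast (by omega)
    unfold ratioBound
    gcongr
  · exact (hF.insert_le h0 hyU hxU h).trans (le_mul_of_one_le_left (h0 _) h1)

theorem MatchingRecursion.le_mul_erase_erase (hF : MatchingRecursion p F) (h0 : ∀ W, 0 ≤ F W)
    (hι : 3 ≤ Fintype.card ι) (hm : ∀ i, #{w | p w = i} = m) (hC : 2 * C < m)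
    {W : Finset V} (hW : Fintype.card V + 3 ≤ #W + C) {v w : V} (hv : v ∈ W) (hw : w ∈ W)
    (hvw : p v ≠ p w) :
    F W ≤ (Fintype.card V - m) * ratioBound C m * F ((W.erase v).erase w) ∧
      (Fintype.card V - m - C) * F ((W.erase v).erase w) ≤ ratioBound C m * F W := by
  have hcard := card_erase_add_one hv
  have hwW : w ∈ W.erase v := mem_erase.2 ⟨fun e => hvw (e ▸ rfl), hw⟩
  have h1 : F W = ∑ x ∈ W.erase v with p x ≠ p v, F ((W.erase v).erase x) := by
    rw [← hF _ v (by simp), insert_erase hv]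
  have h2 := card_filter_add_card_filter_not (s := W.erase v) (fun x => p x = p v)
  have h3 := card_filter_add_card_filter_not (s := (univ : Finset V)) (fun x => p x = p v)
  rw [hm, card_univ] at h3
  have h4 : #{x ∈ W.erase v | p x ≠ p v} ≤ #{x : V | p x ≠ p v} :=
    card_le_card (filter_subset_filter _ (subset_univ _))
  have h5 := card_part_le hm (W.erase v) (p v)
  have h6 : ∀ {x y}, x ∈ W.erase v → y ∈ W.erase v →
      F ((W.erase v).erase x) ≤ ratioBound C m * F ((W.erase v).erase y) :=
    hF.erase_le_mul h0 hι hm hC (by omega)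
  have h7 := one_le_ratioBound C m
  have h8 := h0 ((W.erase v).erase w)
  have h9 : (#{x ∈ W.erase v | p x ≠ p v} : ℝ) ≤ Fintype.card V - m := by
    rw [le_sub_iff_add_le]
    exact_mod_cast (by simp only [ne_eq] at *; omega)
  have h10 : (Fintype.card V - m - C : ℝ) ≤ #{x ∈ W.erase v | p x ≠ p v} := by
    rw [sub_le_iff_le_add, sub_le_iff_le_add]
    exact_mod_cast (by simp only [ne_eq] at *; omega)
  constructor
  · calc F W ≤ ∑ x ∈ W.erase v with p x ≠ p v, ratioBound C m * F ((W.erase v).erase w) := by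
          rw [h1]
          exact sum_le_sum fun x hx => h6 (mem_filter.1 hx).1 hwW
      _ = #{x ∈ W.erase v | p x ≠ p v} * (ratioBound C m * F ((W.erase v).erase w)) := by
          rw [sum_const, nsmul_eq_mul]
      _ ≤ _ := by
          rw [mul_assoc]
          gcongr
  · calc _ ≤ #{x ∈ W.erase v | p x ≠ p v} * F ((W.erase v).erase w) := by gcongr
      _ = ∑ x ∈ W.erase v with p x ≠ p v, F ((W.erase v).erase w) := by
          rw [sum_const, nsmul_eq_mul]
      _ ≤ ∑ x ∈ W.erase v with p x ≠ p v, ratioBound C m * F ((W.erase v).erase x) :=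
          sum_le_sum fun x hx => h6 hwW (mem_filter.1 hx).1
      _ = _ := by rw [h1, mul_sum]

end ratio

section counting
variable {V : Type*} [Fintype V] {G : SimpleGraph V}

open Classical in
/-- The perfect matchings of the subgraph of `G` induced on `W`. -/
noncomputable def matchingsOn (G : SimpleGraph V) (W : Finset V) : Finset (Finset (Sym2 V)) :=
  {M | (∀ e ∈ M, e ∈ G.edgeSet ∧ ∀ v ∈ e, v ∈ W) ∧ ∀ v ∈ W, ∃! e, e ∈ M ∧ v ∈ e}

theorem mem_matchingsOn {W : Finset V} {M : Finset (Sym2 V)} :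
    M ∈ matchingsOn G W ↔
      (∀ e ∈ M, e ∈ G.edgeSet ∧ ∀ v ∈ e, v ∈ W) ∧ ∀ v ∈ W, ∃! e, e ∈ M ∧ v ∈ e := by
  simp [matchingsOn]

theorem eq_of_mem_matchingsOn {W : Finset V} {M : Finset (Sym2 V)} (hM : M ∈ matchingsOn G W)
    {e f : Sym2 V} (he : e ∈ M) (hf : f ∈ M) {v : V} (hve : v ∈ e) (hvf : v ∈ f) : e = f := by
  rw [mem_matchingsOn] at hM
  exact (hM.2 v ((hM.1 e he).2 v hve)).unique ⟨he, hve⟩ ⟨hf, hvf⟩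

theorem mem_matchingsOn_univ {M : Finset (Sym2 V)} : M ∈ matchingsOn G univ ↔ IsPM G M := by
  simp [mem_matchingsOn, IsPM]

theorem pmCount_eq_card : pmCount G = #(matchingsOn G univ) := by
  simp only [pmCount, ← mem_matchingsOn_univ]
  simp

variable [DecidableEq V]

theorem erase_mem_matchingsOn {W : Finset V} {M : Finset (Sym2 V)} (hM : M ∈ matchingsOn G W)
    {a b : V} (h : s(a, b) ∈ M) :
    M.erase s(a, b) ∈ matchingsOn G ((W.erase a).erase b) := by
  have hM' := mem_matchingsOn.1 hM
  rw [mem_matchingsOn]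
  constructor
  · intro e he
    rw [mem_erase] at he
    refine ⟨(hM'.1 e he.2).1, fun v hv => ?_⟩
    rw [mem_erase, mem_erase]
    refine ⟨?_, ?_, (hM'.1 e he.2).2 v hv⟩ <;> rintro rfl <;>
      exact he.1 (eq_of_mem_matchingsOn hM he.2 h hv (by simp))
  · intro v hv
    rw [mem_erase, mem_erase] at hv
    obtain ⟨e, he, huniq⟩ := hM'.2 v hv.2.2
    refine ⟨e, ⟨mem_erase.2 ⟨?_, he.1⟩, he.2⟩, fun f hf => huniq f ⟨(mem_erase.1 hf.1).2, hf.2⟩⟩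
    rintro rfl
    have := he.2
    simp only [Sym2.mem_iff] at this
    tauto

theorem notMem_of_mem_matchingsOn {W : Finset V} {M : Finset (Sym2 V)}
    {a b : V} (hM : M ∈ matchingsOn G ((W.erase a).erase b)) : s(a, b) ∉ M := by
  intro h
  have := ((mem_matchingsOn.1 hM).1 _ h).2 a (by simp)
  simp at this

theorem insert_mem_matchingsOn {W : Finset V} {M : Finset (Sym2 V)} {a b : V} (hab : G.Adj a b)
    (ha : a ∈ W) (hb : b ∈ W) (hM : M ∈ matchingsOn G ((W.erase a).erase b)) :
    insert s(a, b) M ∈ matchingsOn G W := by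
  have hM' := mem_matchingsOn.1 hM
  have hout : ∀ e ∈ M, a ∉ e ∧ b ∉ e := fun e he =>
    ⟨fun h => by simpa using (hM'.1 e he).2 a h, fun h => by simpa using (hM'.1 e he).2 b h⟩
  rw [mem_matchingsOn]
  constructor
  · intro e he
    rcases mem_insert.1 he with rfl | he
    · refine ⟨hab, fun v hv => ?_⟩
      rcases Sym2.mem_iff.1 hv with rfl | rfl <;> assumption
    · exact ⟨(hM'.1 e he).1, fun v hv => mem_of_mem_erase (mem_of_mem_erase ((hM'.1 e he).2 v hv))⟩
  · intro v hv
    by_cases hvab : v ∈ s(a, b)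
    · refine ⟨s(a, b), ⟨mem_insert_self _ _, hvab⟩, fun f hf => ?_⟩
      rcases mem_insert.1 hf.1 with rfl | h
      · rfl
      · rcases Sym2.mem_iff.1 hvab with rfl | rfl
        · exact absurd hf.2 (hout f h).1
        · exact absurd hf.2 (hout f h).2
    · rw [Sym2.mem_iff, not_or] at hvab
      obtain ⟨e, he, huniq⟩ := hM'.2 v (mem_erase.2 ⟨hvab.2, mem_erase.2 ⟨hvab.1, hv⟩⟩)
      refine ⟨e, ⟨mem_insert_of_mem he.1, he.2⟩, fun f hf => huniq f ⟨?_, hf.2⟩⟩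
      refine (mem_insert.1 hf.1).resolve_left ?_
      rintro rfl
      have := hf.2
      rw [Sym2.mem_iff] at this
      tauto

theorem card_matchingsOn_insert_subset {W : Finset V} {S : Finset (Sym2 V)} {a b : V}
    (hab : G.Adj a b) (ha : a ∈ W) (hb : b ∈ W) (hS : s(a, b) ∉ S) :
    #{M ∈ matchingsOn G W | insert s(a, b) S ⊆ M} =
      #{M ∈ matchingsOn G ((W.erase a).erase b) | S ⊆ M} := by
  refine card_bij' (fun M _ => M.erase s(a, b)) (fun M _ => insert s(a, b) M) ?_ ?_ ?_ ?_
  · intro M hM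
    rw [mem_filter, insert_subset_iff] at hM
    exact mem_filter.2 ⟨erase_mem_matchingsOn hM.1 hM.2.1, subset_erase.2 ⟨hM.2.2, hS⟩⟩
  · intro M hM
    rw [mem_filter] at hM
    exact mem_filter.2 ⟨insert_mem_matchingsOn hab ha hb hM.1, insert_subset_insert _ hM.2⟩
  · intro M hM
    rw [mem_filter, insert_subset_iff] at hM
    exact insert_erase hM.2.1
  · intro M hM
    rw [mem_filter] at hM
    exact erase_insert (notMem_of_mem_matchingsOn hM.1)

theorem card_matchingsOn_insert [DecidableRel G.Adj] {W : Finset V} {v : V} (hv : v ∉ W) :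
    #(matchingsOn G (insert v W)) = ∑ w ∈ W with G.Adj v w, #(matchingsOn G (W.erase w)) := by
  have h1 : ∀ w ∈ ({w ∈ W | G.Adj v w} : Finset V), #(matchingsOn G (W.erase w)) =
      #{M ∈ matchingsOn G (insert v W) | s(v, w) ∈ M} := by
    intro w hw
    rw [mem_filter] at hw
    have := card_matchingsOn_insert_subset (W := insert v W) (S := ∅) hw.2 (by simp)
      (mem_insert_of_mem hw.1) (by simp)
    simpa [erase_insert hv, insert_subset_iff] using this.symm
  rw [sum_congr rfl h1]
  have h2 := sum_card_bipartiteAbove_eq_sum_card_bipartiteBelow (s := {w ∈ W | G.Adj v w})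
    (t := matchingsOn G (insert v W)) (fun w M => s(v, w) ∈ M)
  simp only [bipartiteAbove, bipartiteBelow] at h2
  rw [h2, card_eq_sum_ones]
  refine sum_congr rfl fun M hM => ?_
  have hM' := mem_matchingsOn.1 hM
  obtain ⟨e, he, huniq⟩ := hM'.2 v (mem_insert_self _ _)
  obtain ⟨w, rfl⟩ := he.2
  have hadj : G.Adj v w := (hM'.1 _ he.1).1
  symm
  rw [card_eq_one]
  refine ⟨w, ?_⟩
  ext x
  simp only [mem_filter, mem_singleton]
  constructor
  · rintro ⟨-, hx⟩
    exact Sym2.congr_right.1 (huniq _ ⟨hx, by simp⟩)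
  · rintro rfl
    refine ⟨⟨?_, hadj⟩, he.1⟩
    exact (mem_insert.1 ((hM'.1 _ he.1).2 x (by simp))).resolve_left hadj.ne'

theorem two_mul_card_of_isPM {N : Finset (Sym2 V)} (hN : IsPM G N) :
    2 * #N = Fintype.card V := by
  have h := sum_card_bipartiteAbove_eq_sum_card_bipartiteBelow (s := (univ : Finset V))
    (t := N) (fun v e => v ∈ e)
  simp only [bipartiteAbove, bipartiteBelow] at h
  have h1 : ∀ v : V, #{e ∈ N | v ∈ e} = 1 := by
    intro v
    obtain ⟨e, he, huniq⟩ := hN.2 v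
    rw [card_eq_one]
    refine ⟨e, ?_⟩
    ext f
    simp only [mem_filter, mem_singleton]
    exact ⟨huniq f, fun h => h ▸ he⟩
  have h2 : ∀ e ∈ N, #{v | v ∈ e} = 2 := by
    intro e he
    induction e with
    | _ a b =>
    have hab : G.Adj a b := hN.1 _ he
    have : ({v | v ∈ s(a, b)} : Finset V) = {a, b} := by
      ext
      simp
    rw [this, card_pair hab.ne]
  rw [sum_congr rfl fun v _ => h1 v, sum_congr rfl h2] at h
  simp only [sum_const, card_univ, smul_eq_mul] at h
  omega

theorem pmCount_deleteEdges {N : Finset (Sym2 V)} :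
    pmCount (G.deleteEdges (N : Set (Sym2 V))) = #{M ∈ matchingsOn G univ | #(M ∩ N) = 0} := by
  rw [pmCount_eq_card]
  congr 1
  ext M
  simp only [mem_filter, mem_matchingsOn_univ, IsPM, SimpleGraph.edgeSet_deleteEdges, Set.mem_sdiff,
    mem_coe, card_eq_zero, ← disjoint_iff_inter_eq_empty, disjoint_left]
  grind

theorem sum_choose_card_inter {N : Finset (Sym2 V)} (k : ℕ) :
    ∑ M ∈ matchingsOn G univ, (#(M ∩ N)).choose k =
      ∑ S ∈ powersetCard k N, #{M ∈ matchingsOn G univ | S ⊆ M} := by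
  have h := sum_card_bipartiteAbove_eq_sum_card_bipartiteBelow (s := powersetCard k N)
    (t := matchingsOn G univ) (fun S M => S ⊆ M)
  simp only [bipartiteAbove, bipartiteBelow] at h
  rw [h]
  refine sum_congr rfl fun M _ => ?_
  rw [← card_powersetCard]
  congr 1
  ext S
  simp only [mem_powersetCard, mem_filter, subset_inter_iff]
  tauto

end counting

/-- A form of the Bonferroni inequalities. -/
theorem abs_sub_sum_choose_le (x K : ℕ) :
    |(if x = 0 then 1 else 0 : ℝ) - ∑ k ∈ range K, (-1) ^ k * (x.choose k : ℝ)| ≤ x.choose K := by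
  rcases K with _ | K
  · simp only [range_zero, sum_empty, sub_zero, Nat.choose_zero_right]
    split_ifs <;> simp
  rcases x with _ | x
  · simp [sum_range_succ']
  · have h : ∑ k ∈ range (K + 1), (-1) ^ k * ((x + 1).choose k : ℝ) = (-1) ^ K * x.choose K := by
      exact_mod_cast Int.alternating_sum_range_choose_eq_choose (n := x) (m := K)
    rw [h]
    simp only [Nat.add_eq_zero_iff, one_ne_zero, and_false, if_false, zero_sub, abs_neg, abs_mul,
      abs_pow, abs_one, one_pow, one_mul, Nat.abs_cast]
    rw [Nat.choose_succ_succ]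
    push_cast
    have : (0 : ℝ) ≤ x.choose (K + 1) := by positivity
    linarith
section moments
variable {V ι : Type*} [DecidableEq V] [Fintype V] [DecidableEq ι] [Fintype ι]
  {p : V → ι} {G : SimpleGraph V} {m C : ℕ}

omit [Fintype ι] in
theorem matchingRecursion_card (hG : ∀ v w, G.Adj v w ↔ p v ≠ p w) :
    MatchingRecursion p fun W => (#(matchingsOn G W) : ℝ) := by
  classical
  intro W v hv
  simp only [card_matchingsOn_insert hv, hG, Nat.cast_sum, ne_comm]

theorem card_containing_bounds (hG : ∀ v w, G.Adj v w ↔ p v ≠ p w) (hι : 3 ≤ Fintype.card ι)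
    (hm : ∀ i, #{w | p w = i} = m) (hC : 2 * C < m) (hmC : m + C ≤ Fintype.card V)
    {W : Finset V} {S : Finset (Sym2 V)} (hSG : ∀ e ∈ S, e ∈ G.edgeSet)
    (hSW : ∀ e ∈ S, ∀ v ∈ e, v ∈ W) (hS : ∀ e ∈ S, ∀ f ∈ S, ∀ v ∈ e, v ∈ f → e = f)
    (hcard : Fintype.card V + 1 + 2 * #S ≤ #W + C) :
    (#(matchingsOn G W) : ℝ) ≤ ((Fintype.card V - m) * ratioBound C m) ^ #S *
        #{M ∈ matchingsOn G W | S ⊆ M} ∧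
      (Fintype.card V - m - C) ^ #S * (#{M ∈ matchingsOn G W | S ⊆ M} : ℝ) ≤
        ratioBound C m ^ #S * #(matchingsOn G W) := by
  have hθ := one_le_ratioBound C m
  have hD : (m + C : ℝ) ≤ Fintype.card V := by exact_mod_cast hmC
  have hC0 : (0 : ℝ) ≤ C := Nat.cast_nonneg _
  induction S using Finset.induction_on generalizing W with
  | empty => simp
  | insert e S he ih =>
    rw [card_insert_of_notMem he] at hcard ⊢
    induction e with
    | _ a b =>
    have hab : G.Adj a b := hSG _ (mem_insert_self _ _)
    have ha : a ∈ W := hSW _ (mem_insert_self _ _) a (by simp)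
    have hb : b ∈ W := hSW _ (mem_insert_self _ _) b (by simp)
    have hba : b ∈ W.erase a := mem_erase.2 ⟨hab.ne', hb⟩
    have hout : ∀ f ∈ S, ∀ v ∈ f, v ∉ s(a, b) := by
      intro f hf v hvf hv
      exact he (hS _ (mem_insert_self _ _) f (mem_insert_of_mem hf) v hv hvf ▸ hf)
    obtain ⟨h1, h2⟩ := (matchingRecursion_card hG).le_mul_erase_erase
      (fun _ => Nat.cast_nonneg _) hι hm hC (W := W) (by omega) ha hb ((hG a b).1 hab)
    obtain ⟨h3, h4⟩ := ih (W := (W.erase a).erase b)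
      (fun f hf => hSG f (mem_insert_of_mem hf))
      (fun f hf v hv => by
        have h5 := hout f hf v hv
        rw [Sym2.mem_iff, not_or] at h5
        exact mem_erase.2 ⟨h5.2, mem_erase.2 ⟨h5.1, hSW f (mem_insert_of_mem hf) v hv⟩⟩)
      (fun f hf g hg => hS f (mem_insert_of_mem hf) g (mem_insert_of_mem hg))
      (by
        rw [card_erase_of_mem hba, card_erase_of_mem ha]
        omega)
    rw [card_matchingsOn_insert_subset hab ha hb he, pow_succ, pow_succ, pow_succ]
    have hD1 : (0 : ℝ) ≤ Fintype.card V - m := by linarith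
    have hD2 : (0 : ℝ) ≤ Fintype.card V - m - C := by linarith
    constructor
    · calc _ ≤ _ := h1
        _ ≤ (Fintype.card V - m) * ratioBound C m * _ :=
          mul_le_mul_of_nonneg_left h3 (by positivity)
        _ = _ := by ring
    · calc _ = (Fintype.card V - m - C : ℝ) * ((Fintype.card V - m - C) ^ #S *
            #{M ∈ matchingsOn G ((W.erase a).erase b) | S ⊆ M}) := by ring
        _ ≤ (Fintype.card V - m - C : ℝ) * _ := mul_le_mul_of_nonneg_left h4 hD2
        _ = ratioBound C m ^ #S * ((Fintype.card V - m - C : ℝ) *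
            #(matchingsOn G ((W.erase a).erase b))) := by ring
        _ ≤ ratioBound C m ^ #S * _ := mul_le_mul_of_nonneg_left h2 (by positivity)
        _ = _ := by ring

/-- The `k`-th binomial moment of the size of the intersection of `N` with a uniformly random
perfect matching of `G`. -/
noncomputable def interMoment (G : SimpleGraph V) (N : Finset (Sym2 V)) (k : ℕ) : ℝ :=
  (∑ M ∈ matchingsOn G univ, ((#(M ∩ N)).choose k : ℝ)) / #(matchingsOn G univ)

theorem interMoment_bounds (hG : ∀ v w, G.Adj v w ↔ p v ≠ p w) (hι : 3 ≤ Fintype.card ι)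
    (hm : ∀ i, #{w | p w = i} = m) (hC : 2 * C < m) (hmC : m + C < Fintype.card V)
    {N : Finset (Sym2 V)} (hN : IsPM G N) {k : ℕ} (hk : 2 * k + 1 ≤ C) :
    (#N).choose k * (1 / ((Fintype.card V - m) * ratioBound C m)) ^ k ≤ interMoment G N k ∧
      interMoment G N k ≤ (#N).choose k * (ratioBound C m / (Fintype.card V - m - C)) ^ k := by
  have hθ := one_le_ratioBound C m
  have hD : (m + C : ℝ) < Fintype.card V := by exact_mod_cast hmC
  have hC0 : (0 : ℝ) ≤ C := Nat.cast_nonneg _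
  have hD1 : (0 : ℝ) < Fintype.card V - m := by linarith
  have hD2 : (0 : ℝ) < Fintype.card V - m - C := by linarith
  have hpos : (0 : ℝ) < #(matchingsOn G univ) := by
    exact_mod_cast card_pos.2 ⟨N, mem_matchingsOn_univ.2 hN⟩
  have hsum : ∑ M ∈ matchingsOn G univ, ((#(M ∩ N)).choose k : ℝ) =
      ∑ S ∈ powersetCard k N, (#{M ∈ matchingsOn G univ | S ⊆ M} : ℝ) := by
    exact_mod_cast sum_choose_card_inter k
  have hb : ∀ S ∈ powersetCard k N, _ := fun S hS => by
    rw [mem_powersetCard] at hS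
    have := card_containing_bounds hG hι hm hC hmC.le (W := univ) (S := S)
      (fun e he => hN.1 e (hS.1 he)) (fun _ _ _ _ => mem_univ _)
      (fun e he f hf v hve hvf => (hN.2 v).unique ⟨hS.1 he, hve⟩ ⟨hS.1 hf, hvf⟩)
      (by rw [hS.2, card_univ]; omega)
    rw [hS.2] at this
    exact this
  rw [interMoment, hsum, le_div_iff₀ hpos, div_le_iff₀ hpos, ← card_powersetCard, mul_assoc,
    mul_assoc, ← nsmul_eq_mul, ← nsmul_eq_mul]
  constructor
  · refine card_nsmul_le_sum _ _ _ fun S hS => ?_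
    rw [one_div, inv_pow, inv_mul_le_iff₀ (by positivity)]
    exact (hb S hS).1
  · refine sum_le_card_nsmul _ _ _ fun S hS => ?_
    rw [div_pow, div_mul_eq_mul_div, le_div_iff₀ (by positivity), mul_comm]
    exact (hb S hS).2

theorem abs_pm_ratio_sub_le (N : Finset (Sym2 V)) (K : ℕ) (hN : IsPM G N) :
    |(pmCount (G.deleteEdges (N : Set (Sym2 V))) : ℝ) / pmCount G -
      ∑ k ∈ range K, (-1) ^ k * interMoment G N k| ≤ interMoment G N K := by
  have hpos : (0 : ℝ) < #(matchingsOn G univ) := by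
    exact_mod_cast card_pos.2 ⟨N, mem_matchingsOn_univ.2 hN⟩
  have h1 : (pmCount (G.deleteEdges (N : Set (Sym2 V))) : ℝ) =
      ∑ M ∈ matchingsOn G univ, (if #(M ∩ N) = 0 then 1 else 0 : ℝ) := by
    rw [pmCount_deleteEdges, sum_boole]
  have h2 : ∑ k ∈ range K, (-1) ^ k * interMoment G N k =
      (∑ M ∈ matchingsOn G univ, ∑ k ∈ range K, (-1) ^ k * ((#(M ∩ N)).choose k : ℝ)) /
        #(matchingsOn G univ) := by
    rw [sum_comm, sum_div]
    refine sum_congr rfl fun k _ => ?_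
    rw [interMoment, ← mul_sum, mul_div_assoc]
  rw [h1, h2, pmCount_eq_card, ← sub_div, abs_div, abs_of_pos hpos, interMoment,
    ← sum_sub_distrib]
  gcongr
  exact (abs_sum_le_sum_abs _ _).trans (sum_le_sum fun M _ => abs_sub_sum_choose_le _ _)

end moments

section limits
open Filter Topology

theorem tendsto_ratioBound (C : ℕ) : Tendsto (ratioBound C) atTop (𝓝 1) := by
  have h1 : Tendsto (fun m : ℕ => ((m - 2 * C : ℕ) : ℝ)) atTop atTop :=
    tendsto_natCast_atTop_atTop.comp (tendsto_sub_atTop_nat _)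
  have h2 := ((tendsto_const_nhds (x := (3 * C : ℝ))).div_atTop h1).const_add 1
  have h3 := h2.pow (C + 1)
  rw [add_zero, one_pow] at h3
  exact h3

/-- A number is close to `exp (-lam)` if it satisfies Bonferroni inequalities with binomial moments
close to those of the Poisson distribution. -/
theorem exists_moments_imp_close {lam ε : ℝ} (hε : 0 < ε) :
    ∃ K : ℕ, ∃ η > 0, ∀ (x : ℝ) (e : ℕ → ℝ),
      (∀ k ≤ K, |e k - lam ^ k / k.factorial| ≤ η) →
      |x - ∑ k ∈ range K, (-1) ^ k * e k| ≤ e K → |x - Real.exp (-lam)| ≤ ε := by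
  have h1 : Tendsto (fun K : ℕ => ∑ k ∈ range K, (-lam) ^ k / k.factorial) atTop
      (𝓝 (Real.exp (-lam))) := by
    rw [Real.exp_eq_exp_ℝ]
    exact (NormedSpace.expSeries_div_hasSum_exp (-lam)).tendsto_sum_nat
  have h2 := FloorSemiring.tendsto_pow_div_factorial_atTop lam
  obtain ⟨K, hK1, hK2⟩ := ((Metric.tendsto_nhds.1 h1 (ε / 4) (by positivity)).and
    (h2.eventually_lt_const (show (0 : ℝ) < ε / 4 by positivity))).exists
  refine ⟨K, ε / (2 * (K + 1)), by positivity, fun x e he hx => ?_⟩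
  rw [Real.dist_eq] at hK1
  have h3 : |∑ k ∈ range K, (-1) ^ k * e k - ∑ k ∈ range K, (-lam) ^ k / k.factorial| ≤
      K * (ε / (2 * (K + 1))) := by
    rw [← sum_sub_distrib]
    have hterm : ∀ k ∈ range K, |(-1) ^ k * e k - (-lam) ^ k / k.factorial| ≤
        ε / (2 * (K + 1)) := by
      intro k hk
      rw [neg_pow lam, mul_div_assoc, ← mul_sub, abs_mul, abs_pow, abs_neg, abs_one, one_pow, one_mul]
      exact he k (mem_range.1 hk).le
    refine (abs_sum_le_sum_abs _ _).trans ((sum_le_card_nsmul _ _ _ hterm).trans_eq ?_)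
    rw [card_range, nsmul_eq_mul]
  have h4 := (abs_le.1 (he K le_rfl)).2
  have h5 : K * (ε / (2 * (K + 1))) + ε / (2 * (K + 1)) = ε / 2 := by field_simp
  rw [abs_le] at h3 hx ⊢
  rw [abs_lt] at hK1
  constructor <;> linarith

theorem eventually_moment_bounds {r C k : ℕ} (hr : 2 ≤ r) {η : ℝ} (hη : 0 < η) :
    ∀ᶠ h : ℕ in atTop,
      ((r : ℝ) / (2 * (r - 1))) ^ k / k.factorial - η ≤ h.choose k *
        (1 / (2 * h * ((r - 1) / r) * ratioBound C (2 * h / r))) ^ k ∧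
      h.choose k * (ratioBound C (2 * h / r) / (2 * h * ((r - 1) / r) - C)) ^ k ≤
        ((r : ℝ) / (2 * (r - 1))) ^ k / k.factorial + η := by
  have hr1 : (2 : ℝ) ≤ r := by exact_mod_cast hr
  have hr2 : (0 : ℝ) < r - 1 := by linarith
  have hθ : Tendsto (fun h : ℕ => ratioBound C (2 * h / r)) atTop (𝓝 1) :=
    (tendsto_ratioBound C).comp ((Nat.tendsto_div_const_atTop (by omega)).comp
      (tendsto_id.const_mul_atTop' two_pos))
  have hlo : Tendsto (fun h : ℕ => (h : ℝ) *
      (1 / (2 * h * ((r - 1) / r) * ratioBound C (2 * h / r)))) atTop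
      (𝓝 ((r : ℝ) / (2 * (r - 1)))) := by
    have := hθ.inv₀ one_ne_zero |>.const_mul ((r : ℝ) / (2 * (r - 1)))
    rw [inv_one, mul_one] at this
    refine this.congr' ?_
    filter_upwards [eventually_gt_atTop 0] with h hh
    have := one_le_ratioBound C (2 * h / r)
    have : (0 : ℝ) < h := by exact_mod_cast hh
    field_simp
  have hhi : Tendsto (fun h : ℕ => (h : ℝ) *
      (ratioBound C (2 * h / r) / (2 * h * ((r - 1) / r) - C))) atTop
      (𝓝 ((r : ℝ) / (2 * (r - 1)))) := by
    have h1 : Tendsto (fun h : ℕ => (2 * ((r - 1) / r) - C / h : ℝ)) atTop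
        (𝓝 (2 * ((r - 1) / r) - 0)) :=
      tendsto_const_nhds.sub (tendsto_const_nhds.div_atTop tendsto_natCast_atTop_atTop)
    rw [sub_zero] at h1
    have h2 := hθ.div h1 (by positivity)
    rw [show (1 : ℝ) / (2 * ((r - 1) / r)) = r / (2 * (r - 1)) by field_simp] at h2
    refine h2.congr' ?_
    filter_upwards [eventually_gt_atTop 0] with h hh
    have : (0 : ℝ) < h := by exact_mod_cast hh
    simp only [Pi.div_apply]
    rw [show (2 * h * ((r - 1) / r) - C : ℝ) = h * (2 * ((r - 1) / r) - C / h) by field_simp,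
      ← mul_div_assoc (h : ℝ) (ratioBound _ _), mul_div_mul_left _ _ this.ne']
  have h1 := ProbabilityTheory.tendsto_choose_mul_pow_atTop k hlo
  have h2 := ProbabilityTheory.tendsto_choose_mul_pow_atTop k hhi
  filter_upwards [h1.eventually_const_le (sub_lt_self _ hη),
    h2.eventually_le_const (lt_add_of_pos_right _ hη)] with h h3 h4
  exact ⟨h3, h4⟩

end limits

/-- For the complete multipartite graph `G = K_{r×(n/r)}` (with `r ≥ 3`,
`n` even and divisible by `r`) and any perfect matching `N` of `G`, the ratio
`pm(G - N)/pm(G)` is `(1 ± ε) e^{-r/(2(r-1))}`. -/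
theorem pm_ratio_complete_multipartite :
    ∀ r : ℕ, 3 ≤ r →
    ∀ ε : ℝ, 0 < ε →
    ∃ n₀ : ℕ, ∀ n : ℕ, n₀ ≤ n → Even n → r ∣ n →
    ∀ G : SimpleGraph (Σ _ : Fin r, Fin (n / r)),
      G = SimpleGraph.completeMultipartiteGraph (fun _ : Fin r => Fin (n / r)) →
    ∀ N : Finset (Sym2 (Σ _ : Fin r, Fin (n / r))), IsPM G N →
      (1 - ε) * Real.exp (-(r : ℝ) / (2 * ((r : ℝ) - 1))) ≤
        (pmCount (G.deleteEdges (↑N : Set (Sym2 (Σ _ : Fin r, Fin (n / r))))) : ℝ) /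
          (pmCount G : ℝ) ∧
      (pmCount (G.deleteEdges (↑N : Set (Sym2 (Σ _ : Fin r, Fin (n / r))))) : ℝ) /
          (pmCount G : ℝ) ≤
        (1 + ε) * Real.exp (-(r : ℝ) / (2 * ((r : ℝ) - 1))) := by
  intro r hr ε hε
  have hr1 : (3 : ℝ) ≤ r := by exact_mod_cast hr
  have hr0 : (0 : ℝ) < r - 1 := by linarith
  have hexp := Real.exp_pos (-((r : ℝ) / (2 * (r - 1))))
  obtain ⟨K, η, hη, hclose⟩ := exists_moments_imp_close
    (lam := (r : ℝ) / (2 * (r - 1))) (mul_pos hε hexp)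
  have hev : ∀ᶠ h : ℕ in Filter.atTop, ∀ k ∈ range (K + 1), _ :=
    (Filter.eventually_all_finset (range (K + 1))).2 fun k _ =>
      eventually_moment_bounds (r := r) (C := 2 * K + 1) (k := k) (by omega) hη
  obtain ⟨h₀, hh₀⟩ := Filter.eventually_atTop.1 hev
  refine ⟨2 * h₀ + r * (2 * (2 * K + 1) + 1), ?_⟩
  rintro n hn heven ⟨m, rfl⟩ G hG N hN
  obtain ⟨h, hh⟩ := heven
  have hdiv : r * m / r = m := Nat.mul_div_cancel_left m (by omega)
  have hm : ∀ i : Fin r, #{w : Σ _ : Fin r, Fin (r * m / r) | w.1 = i} = m := by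
    intro i
    rw [← Fintype.card_subtype, Fintype.card_congr (Equiv.sigmaSubtype i), Fintype.card_fin, hdiv]
  have hV : Fintype.card (Σ _ : Fin r, Fin (r * m / r)) = r * m := by
    simp [hdiv]
  have hmC : 2 * (2 * K + 1) < m := by
    by_contra! hcon
    have := Nat.mul_le_mul_left r hcon
    rw [mul_add] at hn
    omega
  have hcardN := two_mul_card_of_isPM hN
  rw [hV] at hcardN
  have hNh : #N = h := by omega
  have hmr : 3 * m ≤ r * m := Nat.mul_le_mul_right m hr
  have hm2 : 2 * h / r = m := by rw [← two_mul] at hh; rw [← hh, hdiv]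
  have hD : (2 * h * ((r - 1) / r) : ℝ) = (r * m : ℕ) - m := by
    have : (r * m : ℝ) = h + h := by exact_mod_cast hh
    push_cast
    rw [← two_mul] at this
    rw [← this]
    field_simp
  have hmom : ∀ k ≤ K, |interMoment G N k - ((r : ℝ) / (2 * (r - 1))) ^ k / k.factorial| ≤ η := by
    intro k hk
    have h1 := hh₀ h (by omega) k (mem_range.2 (by omega))
    have h2 := interMoment_bounds (p := Sigma.fst) (C := 2 * K + 1) (fun v w => hG ▸ Iff.rfl)
      (by simpa using hr) hm hmC (by rw [hV]; omega) hN (k := k) (by omega)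
    rw [hm2, hD] at h1
    rw [hV, hNh] at h2
    rw [abs_le]
    constructor <;> linarith [h1.1, h1.2, h2.1, h2.2]
  have := hclose _ _ hmom (abs_pm_ratio_sub_le N K hN)
  rw [neg_div]
  rw [abs_le] at this
  constructor <;> linarith

end RPM
end

section
/- For every α > 1/2 and every ε > 0 there exists n₀ ∈ ℕ such that the following holds for every even n ≥ n₀: if G is a d-regular graph on n vertices with d ≥ αn and N is a perfect matching of G, then (1−ε)·e^{−n/(2d)} ≤ pm(G−N)/pm(G) ≤ (1+ε)·e^{−n/(2d)}, where pm(H) denotes the number of perfect matchings of a graph H and G−N is G with the edges of N removed (in particular pm(G) > 0). -/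
open Finset

namespace RPM

section Walks

variable {V : Type*} [Fintype V] [DecidableEq V] (G : SimpleGraph V) [DecidableRel G.Adj]

/-- The number of sequences `a = x₀, …, xₘ = b` such that `σ xᵢ` is adjacent to `xᵢ₊₁`. -/
noncomputable def walkCount (σ : Equiv.Perm V) : ℕ → V → V → ℝ
  | 0, a, b => if a = b then 1 else 0
  | m + 1, a, b => ∑ c with G.Adj (σ a) c, walkCount σ m c b

variable {G} {d : ℕ}

theorem sum_walkCount (hG : ∀ v, #{u | G.Adj v u} = d) (σ : Equiv.Perm V) (b : V) (m : ℕ) :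
    ∑ a, walkCount G σ m a b = (d : ℝ) ^ m := by
  induction m with
  | zero => simp [walkCount]
  | succ m ih =>
    have h : ∀ c, (#{a | G.Adj (σ a) c} : ℝ) = d := by
      intro c
      rw [← hG c]
      congr 1
      refine card_nbij' σ σ.symm ?_ ?_ ?_ ?_ <;> simp [Set.MapsTo, Set.LeftInvOn, G.adj_comm]
    simp only [walkCount, sum_filter]
    rw [sum_comm]
    simp only [← sum_filter, sum_const, nsmul_eq_mul, h]
    rw [← mul_sum, ih, pow_succ']

theorem sum_sub_sum_le_of_osc {S T : Finset V} (hST : #S = #T) {f : V → ℝ} {D : ℝ}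
    (hf : ∀ a b, f a - f b ≤ D) : ∑ a ∈ S, f a - ∑ a ∈ T, f a ≤ #(S \ T) * D := by
  rcases isEmpty_or_nonempty V with hV | hV
  · simp [Finset.eq_empty_of_isEmpty]
  obtain ⟨c, -, hc⟩ := exists_min_image univ f univ_nonempty
  have h1 := sum_sdiff_sub_sum_sdiff (s₁ := T) (s₂ := S) (f := f)
  have h2 : ∑ a ∈ S \ T, f a ≤ #(S \ T) * (f c + D) := by
    rw [← nsmul_eq_mul]
    exact sum_le_card_nsmul _ _ _ fun a _ => by linarith [hf a c]
  have h3 : #(T \ S) * f c ≤ ∑ a ∈ T \ S, f a := by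
    rw [← nsmul_eq_mul]
    exact card_nsmul_le_sum _ _ _ fun a _ => hc a (mem_univ _)
  have h4 : #(T \ S) = #(S \ T) := card_sdiff_comm hST.symm
  rw [h4] at h3
  linarith

theorem walkCount_sub_le (hG : ∀ v, #{u | G.Adj v u} = d) (hd : d ≤ Fintype.card V)
    (σ : Equiv.Perm V) (b : V) (m : ℕ) (a a' : V) :
    walkCount G σ (m + 1) a b - walkCount G σ (m + 1) a' b ≤ ((Fintype.card V : ℝ) - d) ^ m := by
  induction m generalizing a a' with
  | zero =>
    simp only [walkCount, sum_ite_eq', pow_zero]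
    split_ifs <;> norm_num
  | succ m ih =>
    rw [walkCount, walkCount, pow_succ']
    refine (sum_sub_sum_le_of_osc (by rw [hG, hG]) ih).trans ?_
    have h0 : (0 : ℝ) ≤ (Fintype.card V : ℝ) - d := by
      rw [sub_nonneg]; exact_mod_cast hd
    refine mul_le_mul_of_nonneg_right ?_ (pow_nonneg h0 m)
    rw [le_sub_iff_add_le]
    have h1 : #((univ.filter fun u => G.Adj (σ a) u) \ univ.filter fun u => G.Adj (σ a') u)
        + #(univ.filter fun u => G.Adj (σ a') u) ≤ Fintype.card V := by
      rw [← card_union_of_disjoint sdiff_disjoint]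
      exact card_le_univ _
    rw [hG] at h1
    exact_mod_cast h1

theorem abs_walkCount_sub_le (hG : ∀ v, #{u | G.Adj v u} = d) (hd : d ≤ Fintype.card V)
    (σ : Equiv.Perm V) (m : ℕ) (a b : V) :
    |walkCount G σ (m + 1) a b - (d : ℝ) ^ (m + 1) / Fintype.card V| ≤
      ((Fintype.card V : ℝ) - d) ^ m := by
  have hn : (0 : ℝ) < Fintype.card V := by exact_mod_cast Fintype.card_pos_iff.2 ⟨a⟩
  have h : walkCount G σ (m + 1) a b - (d : ℝ) ^ (m + 1) / Fintype.card V =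
      (∑ a', (walkCount G σ (m + 1) a b - walkCount G σ (m + 1) a' b)) / Fintype.card V := by
    rw [sum_sub_distrib, sum_walkCount hG]
    simp
    field_simp
  have key : |∑ a', (walkCount G σ (m + 1) a b - walkCount G σ (m + 1) a' b)| ≤
      Fintype.card V * ((Fintype.card V : ℝ) - d) ^ m := by
    refine (abs_sum_le_sum_abs _ _).trans ?_
    rw [← nsmul_eq_mul]
    refine sum_le_card_nsmul univ _ _ fun a' _ =>
      abs_le.2 ⟨?_, walkCount_sub_le hG hd σ b m a a'⟩
    linarith [walkCount_sub_le hG hd σ b m a' a]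
  rw [h, abs_div, abs_of_pos hn, div_le_iff₀ hn, mul_comm]
  exact key

/-- The sequences `a = x₀, …, xₘ = b` such that `σ xᵢ` is adjacent to `xᵢ₊₁`. -/
def walks (G : SimpleGraph V) [DecidableRel G.Adj] (σ : Equiv.Perm V) (m : ℕ) (a b : V) :
    Finset (Fin (m + 1) → V) :=
  {x | x 0 = a ∧ x (Fin.last m) = b ∧ ∀ i : Fin m, G.Adj (σ (x i.castSucc)) (x i.succ)}

theorem card_walks (σ : Equiv.Perm V) (m : ℕ) (a b : V) :
    (#(walks G σ m a b) : ℝ) = walkCount G σ m a b := by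
  induction m generalizing a with
  | zero =>
    rw [walkCount]
    split_ifs with h
    · subst h
      have : walks G σ 0 a a = {fun _ => a} := by
        ext x
        simp [walks, funext_iff, Fin.forall_fin_one]
      simp [this]
    · have : walks G σ 0 a b = ∅ := by
        ext x
        simp only [walks, mem_filter, notMem_empty, iff_false]
        rintro ⟨-, rfl, rfl, -⟩
        exact h rfl
      simp [this]
  | succ m ih =>
    rw [walkCount, ← sum_congr rfl fun c _ => ih c, ← Nat.cast_sum, ← card_sigma]
    congr 1
    refine card_nbij' (fun x => ⟨x 1, Fin.tail x⟩) (fun p => Fin.cons a p.2) ?_ ?_ ?_ ?_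
    · intro x hx
      simp only [walks, coe_filter, mem_univ, true_and, Set.mem_ofPred_eq] at hx
      obtain ⟨rfl, rfl, h⟩ := hx
      simp only [coe_sigma, Set.mem_sigma_iff, walks, coe_filter, mem_univ, true_and,
        Set.mem_ofPred_eq]
      exact ⟨by simpa using h 0, rfl, rfl, fun i => h i.succ⟩
    · rintro ⟨c, x⟩ hx
      simp only [coe_sigma, Set.mem_sigma_iff, walks, coe_filter, mem_univ, true_and,
        Set.mem_ofPred_eq] at hx
      obtain ⟨h0, rfl, rfl, h⟩ := hx
      simp only [walks, coe_filter, mem_univ, true_and, Set.mem_ofPred_eq]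
      refine ⟨rfl, rfl, Fin.cases (by simpa using h0) fun i => h i⟩
    · intro x hx
      simp only [walks, coe_filter, mem_univ, true_and, Set.mem_ofPred_eq] at hx
      obtain ⟨rfl, -⟩ := hx
      exact Fin.cons_self_tail x
    · rintro ⟨c, x⟩ hx
      simp only [coe_sigma, Set.mem_sigma_iff, walks, coe_filter, mem_univ, true_and,
        Set.mem_ofPred_eq] at hx
      obtain ⟨h0, rfl, -⟩ := hx
      rfl

end Walks

section Tuples

variable {V : Type*} [Fintype V] [DecidableEq V]

omit [DecidableEq V] in
theorem card_le_pow_of_injOn_compl {ι : Type*} [Fintype ι] [DecidableEq ι] (S : Finset (ι → V))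
    (K : Finset ι) (h : ∀ x ∈ S, ∀ y ∈ S, (∀ i ∉ K, x i = y i) → x = y) :
    #S ≤ Fintype.card V ^ (Fintype.card ι - #K) := by
  have h1 : #S ≤ Fintype.card ({i // i ∉ K} → V) := by
    rw [← card_univ]
    refine card_le_card_of_injOn (fun x i => x i) (fun _ _ => mem_coe.2 (mem_univ _)) ?_
    intro x hx y hy hxy
    exact h x hx y hy fun i hi => congrFun hxy ⟨i, hi⟩
  simpa [Fintype.card_subtype_compl] using h1

/-- Among the tuples with prescribed distinct ends, few satisfy a given relation
`x i = f (x j)` with `i` interior. -/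
theorem card_filter_eq_apply_le (m : ℕ) (a b : V) (f : V → V) {i j : Fin (m + 1)} (hij : j ≠ i)
    (h0 : i ≠ 0) (hl : i ≠ Fin.last m) (hm : m ≠ 0) :
    #{x : Fin (m + 1) → V | x 0 = a ∧ x (Fin.last m) = b ∧ x i = f (x j)} ≤
      Fintype.card V ^ (m - 2) := by
  have h1 : (0 : Fin (m + 1)) ≠ Fin.last m := by
    intro h
    exact hm (by simpa using (congrArg Fin.val h).symm)
  have hK : #({i, 0, Fin.last m} : Finset (Fin (m + 1))) = 3 := by
    rw [card_insert_of_notMem, card_pair h1]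
    simp [h0, hl]
  refine (card_le_pow_of_injOn_compl _ {i, 0, Fin.last m} ?_).trans_eq ?_
  · intro x hx y hy hxy
    simp only [mem_filter, mem_univ, true_and] at hx hy
    simp only [mem_insert, mem_singleton, not_or, and_imp] at hxy
    have h2 : ∀ k, k ≠ i → x k = y k := by
      intro k hk
      by_cases hk0 : k = 0
      · rw [hk0, hx.1, hy.1]
      by_cases hkl : k = Fin.last m
      · rw [hkl, hx.2.1, hy.2.1]
      exact hxy k hk hk0 hkl
    funext k
    by_cases hk : k = i
    · rw [hk, hx.2.2, hy.2.2, h2 j hij]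
    · exact h2 k hk
  · rw [hK, Fintype.card_fin]
    rfl

/-- No interior entry of `x` is the image of another entry under an element of `F`. -/
def InteriorAvoids (F : Finset (Equiv.Perm V)) {m : ℕ} (x : Fin (m + 1) → V) : Prop :=
  ∀ i, i ≠ 0 → i ≠ Fin.last m → ∀ j, j ≠ i → ∀ f ∈ F, x i ≠ f (x j)

theorem card_filter_not_interiorAvoids_le (F : Finset (Equiv.Perm V)) (m : ℕ) (a b : V)
    (hm : m ≠ 0) (S : Finset (Fin (m + 1) → V))
    (hS : ∀ x ∈ S, x 0 = a ∧ x (Fin.last m) = b ∧ ¬ InteriorAvoids F x) :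
    #S ≤ (m + 1) ^ 2 * #F * Fintype.card V ^ (m - 2) := by
  have h1 : S ⊆ ((univ ×ˢ univ ×ˢ F : Finset (Fin (m + 1) × Fin (m + 1) × Equiv.Perm V)).filter
      fun p => p.1 ≠ 0 ∧ p.1 ≠ Fin.last m ∧ p.2.1 ≠ p.1).biUnion fun p =>
        {x : Fin (m + 1) → V | x 0 = a ∧ x (Fin.last m) = b ∧ x p.1 = p.2.2 (x p.2.1)} := by
    intro x hx
    obtain ⟨h0, hl, h⟩ := hS x hx
    simp only [InteriorAvoids, not_forall, not_not] at h
    obtain ⟨i, hi0, hil, j, hij, f, hf, h⟩ := h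
    rw [mem_biUnion]
    exact ⟨(i, j, f), by simp [hi0, hil, hij, hf], by simp [h0, hl, h]⟩
  refine (card_le_card h1).trans ?_
  refine (card_biUnion_le_card_mul _ _ (Fintype.card V ^ (m - 2)) ?_).trans ?_
  · rintro ⟨i, j, f⟩ hp
    simp only [mem_filter] at hp
    exact card_filter_eq_apply_le m a b f hp.2.2.2 hp.2.1 hp.2.2.1 hm
  · refine Nat.mul_le_mul_right _ ((card_filter_le _ _).trans_eq ?_)
    simp [card_product]
    ring

end Tuples

section GoodWalks

variable {V : Type*} [Fintype V] [DecidableEq V] {G : SimpleGraph V} [DecidableRel G.Adj] {d : ℕ}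

open Classical in
/-- The walks whose interior entries avoid the images under `F` of the other entries. -/
noncomputable def goodWalks (G : SimpleGraph V) [DecidableRel G.Adj] (F : Finset (Equiv.Perm V))
    (σ : Equiv.Perm V) (m : ℕ) (a b : V) : Finset (Fin (m + 1) → V) :=
  {x ∈ walks G σ m a b | InteriorAvoids F x}

theorem card_walks_le_card_goodWalks_add (F : Finset (Equiv.Perm V)) (σ : Equiv.Perm V) {m : ℕ}
    (hm : m ≠ 0) (a b : V) :
    #(walks G σ m a b) ≤
      #(goodWalks G F σ m a b) + (m + 1) ^ 2 * #F * Fintype.card V ^ (m - 2) := by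
  classical
  rw [← card_filter_add_card_filter_not (s := walks G σ m a b) (InteriorAvoids F)]
  refine Nat.add_le_add (le_of_eq ?_) (card_filter_not_interiorAvoids_le F m a b hm _ ?_)
  · unfold goodWalks; congr
  · intro x hx
    simp only [mem_filter, walks, mem_univ, true_and] at hx
    exact ⟨hx.1.1, hx.1.2.1, hx.2⟩

end GoodWalks

section Switching

variable {V : Type*} [Fintype V] [DecidableEq V] {G : SimpleGraph V} {m : ℕ}

/-- `σ` is an involution matching every vertex with one of its neighbours in `G`. -/
def IsPMPerm (G : SimpleGraph V) (σ : Equiv.Perm V) : Prop :=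
  ∀ v, σ (σ v) = v ∧ G.Adj v (σ v)

omit [Fintype V] [DecidableEq V] in
theorem IsPMPerm.apply_ne {σ : Equiv.Perm V} (h : IsPMPerm G σ) (v : V) : σ v ≠ v :=
  (h v).2.ne'

/-- The edges `{xᵢ, σ xᵢ}` and `{σ xᵢ, xᵢ₊₁}` form a cycle in `G`, the indices being cyclic. -/
structure IsAlternating (G : SimpleGraph V) (σ : Equiv.Perm V) (x : Fin (m + 1) → V) : Prop where
  inj : Function.Injective x
  apply_ne : ∀ i j, σ (x i) ≠ x j
  adj : ∀ i, G.Adj (σ (x i)) (x (i + 1))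

open Classical in
/-- The permutation mapping `xᵢ` to `xᵢ₊₁` cyclically and fixing everything else. -/
noncomputable def rot (x : Fin (m + 1) → V) : Equiv.Perm V :=
  if h : Function.Injective x then
    Equiv.Perm.viaFintypeEmbedding (Equiv.addRight (1 : Fin (m + 1))) ⟨x, h⟩
  else 1

omit [Fintype V] in
theorem rot_apply {x : Fin (m + 1) → V} (h : Function.Injective x) (i : Fin (m + 1)) :
    rot x (x i) = x (i + 1) := by
  rw [rot, dif_pos h]
  exact Equiv.Perm.viaFintypeEmbedding_apply_image (Equiv.addRight (1 : Fin (m + 1))) ⟨x, h⟩ i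

omit [Fintype V] in
theorem rot_apply_of_ne {x : Fin (m + 1) → V} {v : V} (h : ∀ i, x i ≠ v) : rot x v = v := by
  unfold rot
  split_ifs with hx
  · apply Equiv.Perm.viaFintypeEmbedding_apply_notMem_range
    rintro ⟨i, hi⟩
    exact h i hi
  · rfl

/-- Exchange the edges `{xᵢ, σ xᵢ}` of a matching for the edges `{σ xᵢ, xᵢ₊₁}`. -/
noncomputable def switch (σ : Equiv.Perm V) (x : Fin (m + 1) → V) : Equiv.Perm V :=
  rot x * σ * (rot x)⁻¹

omit [Fintype V] in
theorem switch_right_injective {σ τ : Equiv.Perm V} {x : Fin (m + 1) → V}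
    (h : switch σ x = switch τ x) : σ = τ := by
  simpa [switch] using h

variable {σ : Equiv.Perm V} {x : Fin (m + 1) → V}

namespace IsAlternating

omit [Fintype V] in
theorem switch_apply_add_one (hx : IsAlternating G σ x) (i : Fin (m + 1)) :
    switch σ x (x (i + 1)) = σ (x i) := by
  rw [switch, Equiv.Perm.mul_apply, Equiv.Perm.mul_apply,
    Equiv.Perm.inv_eq_iff_eq.2 (rot_apply hx.inj i).symm]
  exact rot_apply_of_ne fun j => (hx.apply_ne i j).symm

omit [Fintype V] in
theorem switch_apply_of_ne {v : V} (hv : ∀ i, x i ≠ v) : switch σ x v = rot x (σ v) := by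
  rw [switch, Equiv.Perm.mul_apply, Equiv.Perm.mul_apply,
    Equiv.Perm.inv_eq_iff_eq.2 (rot_apply_of_ne hv).symm]

omit [Fintype V] in
theorem switch_apply_apply (hx : IsAlternating G σ x) (hσ : IsPMPerm G σ) (i : Fin (m + 1)) :
    switch σ x (σ (x i)) = x (i + 1) := by
  rw [switch_apply_of_ne fun j => (hx.apply_ne i j).symm, (hσ _).1, rot_apply hx.inj]

omit [Fintype V] in
theorem switch_apply_eq {v : V} (h1 : ∀ i, x i ≠ v) (h2 : ∀ i, x i ≠ σ v) :
    switch σ x v = σ v := by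
  rw [switch_apply_of_ne h1, rot_apply_of_ne h2]

omit [Fintype V] in
theorem cases_vertex (hσ : IsPMPerm G σ) (x : Fin (m + 1) → V) (v : V) :
    (∃ i, v = x (i + 1)) ∨ (∃ i, v = σ (x i)) ∨ ((∀ i, x i ≠ v) ∧ ∀ i, x i ≠ σ v) := by
  by_cases h1 : ∃ i, x i = v
  · obtain ⟨i, hi⟩ := h1
    exact Or.inl ⟨i - 1, by rw [sub_add_cancel, hi]⟩
  by_cases h2 : ∃ i, x i = σ v
  · obtain ⟨i, hi⟩ := h2
    exact Or.inr (Or.inl ⟨i, by rw [hi, (hσ v).1]⟩)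
  push Not at h1 h2
  exact Or.inr (Or.inr ⟨h1, h2⟩)

omit [Fintype V] in
theorem isPMPerm_switch (hx : IsAlternating G σ x) (hσ : IsPMPerm G σ) :
    IsPMPerm G (switch σ x) := by
  have h1 : σ * σ = 1 := Equiv.ext fun v => (hσ v).1
  have h2 : switch σ x * switch σ x = 1 := by
    rw [switch, show rot x * σ * (rot x)⁻¹ * (rot x * σ * (rot x)⁻¹) =
      rot x * (σ * σ) * (rot x)⁻¹ by group, h1]
    group
  refine fun v => ⟨congrArg (fun τ : Equiv.Perm V => τ v) h2, ?_⟩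
  rcases cases_vertex hσ x v with ⟨i, rfl⟩ | ⟨i, rfl⟩ | ⟨h3, h4⟩
  · rw [hx.switch_apply_add_one]
    exact (hx.adj i).symm
  · rw [hx.switch_apply_apply hσ]
    exact hx.adj i
  · rw [switch_apply_eq h3 h4]
    exact (hσ v).2

omit [Fintype V] in
theorem adj_switch_neg (hx : IsAlternating G σ x) (hσ : IsPMPerm G σ) (i : Fin (m + 1)) :
    G.Adj (switch σ x (x (-i))) (x (-(i + 1))) := by
  have h : -i = -(i + 1) + 1 := by abel
  rw [h, hx.switch_apply_add_one]
  exact (hσ _).2.symm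

end IsAlternating

/-- The set of vertices matched in the same way by `ν` and `σ`. -/
def agree (ν σ : Equiv.Perm V) : Finset V := {v | σ v = ν v}

theorem mem_agree {ν σ : Equiv.Perm V} {v : V} : v ∈ agree ν σ ↔ σ v = ν v := by
  simp [agree]

variable {ν : Equiv.Perm V}

theorem apply_mem_agree (hν : IsPMPerm G ν) (hσ : IsPMPerm G σ) {v : V} (h : v ∈ agree ν σ) :
    σ v ∈ agree ν σ := by
  rw [mem_agree] at *
  rw [(hσ v).1, h, (hν v).1]

theorem card_agree_switch_add_two_le (hν : IsPMPerm G ν) (hσ : IsPMPerm G σ)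
    (hx : IsAlternating G σ x) (h0 : x 0 ∈ agree ν σ) (h : ∀ i, σ (x i) ≠ ν (x (i + 1))) :
    #(agree ν (switch σ x)) + 2 ≤ #(agree ν σ) := by
  have h1 : agree ν (switch σ x) ⊆ (agree ν σ).filter fun v => (∀ i, x i ≠ v) ∧ ∀ i, x i ≠ σ v := by
    intro v hv
    rw [mem_agree] at hv
    rw [mem_filter, mem_agree]
    rcases IsAlternating.cases_vertex hσ x v with ⟨i, rfl⟩ | ⟨i, rfl⟩ | ⟨h3, h4⟩
    · rw [hx.switch_apply_add_one] at hv
      exact absurd hv (h i)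
    · rw [hx.switch_apply_apply hσ] at hv
      exact absurd (by rw [hv, (hν _).1]) (h i)
    · rw [IsAlternating.switch_apply_eq h3 h4] at hv
      exact ⟨hv, h3, h4⟩
  have h2 : ({x 0, σ (x 0)} : Finset V) ⊆ agree ν σ \ agree ν (switch σ x) := by
    intro v hv
    rw [mem_sdiff]
    rw [mem_insert, mem_singleton] at hv
    rcases hv with rfl | rfl
    · exact ⟨h0, fun h3 => (mem_filter.1 (h1 h3)).2.1 0 rfl⟩
    · exact ⟨apply_mem_agree hν hσ h0, fun h3 => (mem_filter.1 (h1 h3)).2.2 0 (hσ _).1.symm⟩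
  have h3 := card_le_card h2
  rw [card_pair (hσ.apply_ne _).symm,
    card_sdiff_of_subset (h1.trans (filter_subset _ _))] at h3
  have h4 := card_le_card (h1.trans (filter_subset _ _))
  omega

theorem card_agree_switch_le (hν : IsPMPerm G ν) (hσ : IsPMPerm G σ)
    (hx : IsAlternating G σ x) (h : ∀ i, i ≠ Fin.last m → σ (x i) ≠ ν (x (i + 1))) :
    #(agree ν (switch σ x)) ≤ #(agree ν σ) + 2 := by
  have h1 : agree ν (switch σ x) ⊆ agree ν σ ∪ {x 0, ν (x 0)} := by
    intro v hv
    rw [mem_agree] at hv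
    rw [mem_union, mem_agree, mem_insert, mem_singleton]
    rcases IsAlternating.cases_vertex hσ x v with ⟨i, rfl⟩ | ⟨i, rfl⟩ | ⟨h3, h4⟩
    · rw [hx.switch_apply_add_one] at hv
      by_cases hi : i = Fin.last m
      · exact Or.inr (Or.inl (by rw [hi, Fin.last_add_one]))
      · exact absurd hv (h i hi)
    · rw [hx.switch_apply_apply hσ] at hv
      have hv' : σ (x i) = ν (x (i + 1)) := by rw [hv, (hν _).1]
      by_cases hi : i = Fin.last m
      · exact Or.inr (Or.inr (by rw [hv', hi, Fin.last_add_one]))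
      · exact absurd hv' (h i hi)
    · rw [IsAlternating.switch_apply_eq h3 h4] at hv
      exact Or.inl hv
  refine (card_le_card h1).trans ((card_union_le _ _).trans ?_)
  exact Nat.add_le_add_left card_le_two _

variable [DecidableRel G.Adj]

theorem mem_goodWalks_props (hm : 2 ≤ m) (hν : IsPMPerm G ν) (hσ : IsPMPerm G σ) {a b : V}
    (hab : a ≠ b) (hab' : σ a ≠ b) (hx : x ∈ goodWalks G {1, σ, ν * σ, σ * ν} σ m a b) :
    (x 0 = a ∧ x (Fin.last m) = b) ∧ Function.Injective x ∧ (∀ i j, σ (x i) ≠ x j) ∧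
      (∀ i, i ≠ Fin.last m → G.Adj (σ (x i)) (x (i + 1)) ∧ σ (x i) ≠ ν (x (i + 1))) := by
  simp only [goodWalks, walks, mem_filter, mem_univ, true_and, InteriorAvoids, mem_insert,
    mem_singleton, forall_eq_or_imp, forall_eq, Equiv.Perm.mul_apply, Equiv.Perm.one_apply] at hx
  obtain ⟨⟨rfl, rfl, hadj⟩, hx⟩ := hx
  refine ⟨⟨rfl, rfl⟩, ?_, ?_, ?_⟩
  · intro i j hij
    by_contra hne
    by_cases hi : i ≠ 0 ∧ i ≠ Fin.last m
    · exact (hx i hi.1 hi.2 j (Ne.symm hne)).1 hij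
    by_cases hj : j ≠ 0 ∧ j ≠ Fin.last m
    · exact (hx j hj.1 hj.2 i hne).1 hij.symm
    have hi' : i = 0 ∨ i = Fin.last m := by tauto
    have hj' : j = 0 ∨ j = Fin.last m := by tauto
    rcases hi' with rfl | rfl <;> rcases hj' with rfl | rfl
    · exact hne rfl
    · exact hab hij
    · exact hab hij.symm
    · exact hne rfl
  · intro i j hij
    by_cases hne : i = j
    · subst hne
      exact hσ.apply_ne _ hij
    by_cases hi : i ≠ 0 ∧ i ≠ Fin.last m
    · exact (hx i hi.1 hi.2 j (Ne.symm hne)).2.1 (by rw [← hij, (hσ _).1])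
    by_cases hj : j ≠ 0 ∧ j ≠ Fin.last m
    · exact (hx j hj.1 hj.2 i hne).2.1 hij.symm
    have hi' : i = 0 ∨ i = Fin.last m := by tauto
    have hj' : j = 0 ∨ j = Fin.last m := by tauto
    rcases hi' with rfl | rfl <;> rcases hj' with rfl | rfl
    · exact hne rfl
    · exact hab' hij
    · exact hab' (by rw [← hij, (hσ _).1])
    · exact hne rfl
  · intro i hi
    obtain ⟨k, rfl⟩ := Fin.exists_castSucc_eq.2 hi
    rw [Fin.coeSucc_eq_succ]
    refine ⟨hadj k, fun h => ?_⟩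
    by_cases hk : k.succ = Fin.last m
    · have hk0 : k.castSucc ≠ 0 := by
        intro h0
        have e1 := congrArg Fin.val h0
        have e2 := congrArg Fin.val hk
        simp at e1 e2
        omega
      refine (hx _ hk0 hi k.succ (Fin.castSucc_lt_succ).ne').2.2.2 ?_
      rw [← h, (hσ _).1]
    · refine (hx _ (Fin.succ_ne_zero k) hk k.castSucc (Fin.castSucc_lt_succ).ne).2.2.1 ?_
      rw [h, (hν _).1]

end Switching

section DoubleCounting

variable {V : Type*} [Fintype V] [DecidableEq V] {G : SimpleGraph V} [DecidableRel G.Adj]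
  {d m : ℕ} {ν : Equiv.Perm V} {ℓ u t : ℝ}

open Classical in
/-- The perfect matchings of `G`, as fixed-point-free involutions. -/
noncomputable def pmPerms (G : SimpleGraph V) : Finset (Equiv.Perm V) := {σ | IsPMPerm G σ}

omit [DecidableRel G.Adj] in
theorem mem_pmPerms {σ : Equiv.Perm V} : σ ∈ pmPerms G ↔ IsPMPerm G σ := by
  simp [pmPerms]

omit [DecidableEq V] in
theorem card_filter_adj_apply (hG : ∀ v, #{w | G.Adj v w} = d) (σ : Equiv.Perm V) (a : V) :
    #{b | G.Adj (σ b) a} = d := by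
  rw [← hG a]
  refine card_nbij' σ σ.symm ?_ ?_ ?_ ?_ <;> simp [Set.MapsTo, Set.LeftInvOn, G.adj_comm]

theorem sum_sigma_fst {ι : Type*} {κ : ι → Type*} (s : Finset ι) (S : ∀ i, Finset (κ i))
    (f : ι → ℝ) : ∑ p ∈ s.sigma S, f p.1 = ∑ i ∈ s, #(S i) * f i := by
  simp [sum_sigma]

theorem sum_le_sum_of_injOn {ι κ : Type*} [DecidableEq κ] {s : Finset ι} {s' : Finset κ}
    {f : ι → ℝ} {g : κ → ℝ} (e : ι → κ) (he : ∀ i ∈ s, e i ∈ s') (hinj : Set.InjOn e s)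
    (hg : ∀ k ∈ s', 0 ≤ g k) (h : ∀ i ∈ s, f i ≤ g (e i)) : ∑ i ∈ s, f i ≤ ∑ k ∈ s', g k := by
  refine (sum_le_sum h).trans ?_
  rw [← sum_image hinj]
  exact sum_le_sum_of_subset_of_nonneg (image_subset_iff.2 he) fun k hk _ => hg k hk

/-- The vertices `b` such that a walk from `a` to `b` closes up. -/
def closers (G : SimpleGraph V) [DecidableRel G.Adj] (σ : Equiv.Perm V) (a : V) : Finset V :=
  {b | G.Adj (σ b) a}

open Classical in
/-- The alternating cycles through `{x₀, σ x₀} ∈ ν` whose switching creates no edge of `ν`. -/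
noncomputable def removingCycles (G : SimpleGraph V) (ν : Equiv.Perm V) (m : ℕ)
    (σ : Equiv.Perm V) : Finset (Fin (m + 1) → V) :=
  {x | IsAlternating G σ x ∧ x 0 ∈ agree ν σ ∧ ∀ i, σ (x i) ≠ ν (x (i + 1))}

/-- The walks closed up by the edge `{x₀, ν x₀}`. -/
def addingWalks (G : SimpleGraph V) [DecidableRel G.Adj] (ν : Equiv.Perm V) (m : ℕ)
    (σ : Equiv.Perm V) : Finset (Fin (m + 1) → V) :=
  {x | x ∈ walks G σ m (x 0) (σ (ν (x 0)))}

/-- The good walks closed up by an edge `{x₀, ν x₀}` outside `σ`. -/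
noncomputable def goodAddingWalks (G : SimpleGraph V) [DecidableRel G.Adj] (ν : Equiv.Perm V)
    (m : ℕ) (σ : Equiv.Perm V) : Finset (Fin (m + 1) → V) :=
  {x | x 0 ∉ agree ν σ ∧ x ∈ goodWalks G {1, σ, ν * σ, σ * ν} σ m (x 0) (σ (ν (x 0)))}

/-- The closed walks starting with an edge `{x₀, σ x₀} ∈ ν`. -/
def removingWalks (G : SimpleGraph V) [DecidableRel G.Adj] (ν : Equiv.Perm V) (m : ℕ)
    (σ : Equiv.Perm V) : Finset (Fin (m + 1) → V) :=
  {x | x 0 ∈ agree ν σ ∧ ∀ i, G.Adj (σ (x i)) (x (i + 1))}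

theorem le_card_removingCycles (hG : ∀ v, #{w | G.Adj v w} = d) (hm : 2 ≤ m) (hℓ : 0 ≤ ℓ)
    (hν : IsPMPerm G ν) {σ : Equiv.Perm V} (hσ : IsPMPerm G σ)
    (hgood : ∀ a b, ℓ ≤ #(goodWalks G {1, σ, ν * σ, σ * ν} σ m a b)) :
    #(agree ν σ) * (((d : ℝ) - 1) * ℓ) ≤ #(removingCycles G ν m σ) := by
  have h1 : #(((agree ν σ).sigma fun a => (closers G σ a).erase a).sigma fun p =>
      goodWalks G {1, σ, ν * σ, σ * ν} σ m p.1 p.2) ≤ #(removingCycles G ν m σ) := by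
    have key : ∀ a ∈ agree ν σ, ∀ b ∈ (closers G σ a).erase a, ∀ x,
        x ∈ goodWalks G {1, σ, ν * σ, σ * ν} σ m a b →
        (x 0 = a ∧ x (Fin.last m) = b) ∧ x ∈ removingCycles G ν m σ := by
      intro a ha b hb x hx
      simp only [closers, mem_erase, mem_filter, mem_univ, true_and] at hb
      have hab : σ a ≠ b := by
        rintro rfl
        rw [(hσ a).1] at hb
        exact hb.2.ne rfl
      obtain ⟨⟨h0, hl⟩, h1, h2, h3⟩ := mem_goodWalks_props hm hν hσ hb.1.symm hab hx
      refine ⟨⟨h0, hl⟩, ?_⟩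
      simp only [removingCycles, mem_filter, mem_univ, true_and]
      refine ⟨⟨h1, h2, fun i => ?_⟩, h0 ▸ ha, fun i => ?_⟩
      · by_cases hi : i = Fin.last m
        · rw [hi, hl, Fin.last_add_one, h0]
          exact hb.2
        · exact (h3 i hi).1
      · by_cases hi : i = Fin.last m
        · rw [hi, hl, Fin.last_add_one, h0, ← mem_agree.1 ha]
          exact fun h => hb.1 (σ.injective h)
        · exact (h3 i hi).2
    refine card_le_card_of_injOn (fun p => p.2) ?_ ?_
    · rintro ⟨⟨a, b⟩, x⟩ hp
      simp only [coe_sigma, Set.mem_sigma_iff, mem_coe] at hp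
      exact (key a hp.1.1 b hp.1.2 x hp.2).2
    · rintro ⟨⟨a, b⟩, x⟩ hp ⟨⟨a', b'⟩, x'⟩ hp' h
      simp only [coe_sigma, Set.mem_sigma_iff, mem_coe] at hp hp' h
      subst h
      obtain ⟨h0, hl⟩ := (key a hp.1.1 b hp.1.2 x hp.2).1
      obtain ⟨h0', hl'⟩ := (key a' hp'.1.1 b' hp'.1.2 x hp'.2).1
      rw [← h0, ← hl, ← h0', ← hl']
  refine le_trans ?_ (Nat.cast_le.2 h1)
  rw [card_sigma, Nat.cast_sum]
  have h2 : ∀ a, (d : ℝ) - 1 ≤ #((closers G σ a).erase a) := by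
    intro a
    have := pred_card_le_card_erase (s := closers G σ a) (a := a)
    rw [closers, card_filter_adj_apply hG] at this
    rw [sub_le_iff_le_add]
    have h3 : d ≤ #((closers G σ a).erase a) + 1 := by
      rw [closers]
      omega
    exact_mod_cast h3
  calc #(agree ν σ) * (((d : ℝ) - 1) * ℓ)
      = ∑ a ∈ agree ν σ, ((d : ℝ) - 1) * ℓ := by simp
    _ ≤ ∑ a ∈ agree ν σ, (#((closers G σ a).erase a) : ℝ) * ℓ :=
        sum_le_sum fun a _ => mul_le_mul_of_nonneg_right (h2 a) hℓ
    _ = ∑ p ∈ (agree ν σ).sigma fun a => (closers G σ a).erase a, ℓ := by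
        rw [sum_sigma_fst (f := fun _ => ℓ)]
    _ ≤ _ := sum_le_sum fun p _ => hgood p.1 p.2

theorem card_addingWalks_le {σ : Equiv.Perm V} (hw : ∀ a b, (#(walks G σ m a b) : ℝ) ≤ u) :
    (#(addingWalks G ν m σ) : ℝ) ≤ Fintype.card V * u := by
  have h1 : addingWalks G ν m σ ⊆ univ.biUnion fun a => walks G σ m a (σ (ν a)) := by
    intro x hx
    simp only [addingWalks, mem_filter, mem_univ, true_and] at hx
    exact mem_biUnion.2 ⟨x 0, mem_univ _, hx⟩
  refine (Nat.cast_le.2 ((card_le_card h1).trans card_biUnion_le)).trans ?_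
  rw [Nat.cast_sum, ← nsmul_eq_mul, ← card_univ]
  exact sum_le_card_nsmul _ _ _ fun a _ => hw _ _

theorem card_removingWalks_le (hG : ∀ v, #{w | G.Adj v w} = d) {σ : Equiv.Perm V}
    (hw : ∀ a b, (#(walks G σ m a b) : ℝ) ≤ u) :
    (#(removingWalks G ν m σ) : ℝ) ≤ #(agree ν σ) * (d * u) := by
  have h1 : removingWalks G ν m σ ⊆ ((agree ν σ).sigma fun a => closers G σ a).biUnion fun p =>
      walks G σ m p.1 p.2 := by
    intro x hx
    simp only [removingWalks, mem_filter, mem_univ, true_and] at hx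
    refine mem_biUnion.2 ⟨⟨x 0, x (Fin.last m)⟩, ?_, ?_⟩
    · have := hx.2 (Fin.last m)
      rw [Fin.last_add_one] at this
      simp [closers, hx.1, this]
    · simp only [walks, mem_filter, mem_univ, true_and]
      intro i
      have := hx.2 i.castSucc
      rwa [Fin.coeSucc_eq_succ] at this
  refine (Nat.cast_le.2 ((card_le_card h1).trans card_biUnion_le)).trans ?_
  rw [Nat.cast_sum]
  refine (sum_le_card_nsmul _ _ u fun p _ => hw _ _).trans_eq ?_
  rw [card_sigma]
  simp only [closers, card_filter_adj_apply hG]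
  simp [mul_assoc]

theorem le_card_goodAddingWalks {σ : Equiv.Perm V}
    (hgood : ∀ a b, ℓ ≤ #(goodWalks G {1, σ, ν * σ, σ * ν} σ m a b)) :
    ((Fintype.card V : ℝ) - #(agree ν σ)) * ℓ ≤ #(goodAddingWalks G ν m σ) := by
  have h1 : #((agree ν σ)ᶜ.sigma fun a => goodWalks G {1, σ, ν * σ, σ * ν} σ m a (σ (ν a))) ≤
      #(goodAddingWalks G ν m σ) := by
    have key : ∀ a, ∀ x ∈ goodWalks G {1, σ, ν * σ, σ * ν} σ m a (σ (ν a)), x 0 = a := by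
      intro a x hx
      simp only [goodWalks, walks, mem_filter, mem_univ, true_and] at hx
      exact hx.1.1
    refine card_le_card_of_injOn (fun p => p.2) ?_ ?_
    · rintro ⟨a, x⟩ hp
      simp only [coe_sigma, Set.mem_sigma_iff, mem_coe, mem_compl] at hp
      have h0 := key a x hp.2
      subst h0
      simpa [goodAddingWalks] using hp
    · rintro ⟨a, x⟩ hp ⟨a', x'⟩ hp' h
      simp only [coe_sigma, Set.mem_sigma_iff, mem_coe] at hp hp' h
      subst h
      rw [← key a x hp.2, ← key a' x hp'.2]
  refine le_trans ?_ (Nat.cast_le.2 h1)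
  rw [card_sigma, Nat.cast_sum, ← Nat.cast_sub (card_le_univ _), ← card_compl, ← nsmul_eq_mul]
  exact card_nsmul_le_sum _ _ _ fun a _ => hgood _ _

/-- Switching the alternating cycles removing an edge of `ν`. -/
theorem sum_removingCycles_le (hν : IsPMPerm G ν) (h0 : 0 ≤ t) (h1 : t ≤ 1) :
    ∑ σ ∈ pmPerms G, #(removingCycles G ν m σ) * t ^ (#(agree ν σ) - 1) ≤
      ∑ σ ∈ pmPerms G, #(addingWalks G ν m σ) * t ^ (#(agree ν σ) + 1) := by
  rw [← sum_sigma_fst _ (removingCycles G ν m), ← sum_sigma_fst _ (addingWalks G ν m)]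
  refine sum_le_sum_of_injOn (fun p => ⟨switch p.1 p.2, fun i => p.2 (-i)⟩) ?_ ?_ ?_ ?_
  · rintro ⟨σ, x⟩ hp
    simp only [mem_sigma, mem_pmPerms, removingCycles, mem_filter, mem_univ, true_and] at hp
    obtain ⟨hσ, hx, hx0, -⟩ := hp
    simp only [mem_sigma, mem_pmPerms, addingWalks, walks, mem_filter, mem_univ, true_and]
    refine ⟨hx.isPMPerm_switch hσ, ?_, fun i => ?_⟩
    · have h2 : -Fin.last m = 0 + 1 := by
        rw [neg_eq_iff_add_eq_zero, zero_add, Fin.last_add_one]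
      rw [neg_zero, ← mem_agree.1 hx0, hx.switch_apply_apply hσ, h2]
    · rw [← Fin.coeSucc_eq_succ]
      exact hx.adj_switch_neg hσ _
  · rintro ⟨σ, x⟩ - ⟨τ, y⟩ - h
    simp only [Sigma.mk.injEq, heq_eq_eq] at h
    have hxy : x = y := funext fun i => by simpa using congrFun h.2 (-i)
    subst hxy
    rw [switch_right_injective h.1]
  · intro q _
    positivity
  · rintro ⟨σ, x⟩ hp
    simp only [mem_sigma, mem_pmPerms, removingCycles, mem_filter, mem_univ, true_and] at hp
    obtain ⟨hσ, hx, hx0, h⟩ := hp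
    have := card_agree_switch_add_two_le hν hσ hx hx0 h
    exact pow_le_pow_of_le_one h0 h1 (by dsimp only; omega)

/-- Switching the alternating cycles adding an edge of `ν`. -/
theorem sum_goodAddingWalks_le (hm : 2 ≤ m) (hν : IsPMPerm G ν) (h0 : 0 ≤ t) (h1 : t ≤ 1) :
    ∑ σ ∈ pmPerms G, #(goodAddingWalks G ν m σ) * t ^ (#(agree ν σ) + 1) ≤
      ∑ σ ∈ pmPerms G, #(removingWalks G ν m σ) * t ^ (#(agree ν σ) - 1) := by
  have key : ∀ σ, IsPMPerm G σ → ∀ x ∈ goodAddingWalks G ν m σ,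
      x (Fin.last m) = σ (ν (x 0)) ∧ IsAlternating G σ x ∧
        ∀ i, i ≠ Fin.last m → σ (x i) ≠ ν (x (i + 1)) := by
    intro σ hσ x hx
    simp only [goodAddingWalks, mem_filter, mem_univ, true_and, mem_agree] at hx
    have h2 : x 0 ≠ σ (ν (x 0)) := fun h => hx.1 (by
      have := congrArg σ h
      rwa [(hσ _).1] at this)
    have h3 : σ (x 0) ≠ σ (ν (x 0)) := fun h => hν.apply_ne (x 0) (σ.injective h).symm
    obtain ⟨⟨-, hl⟩, h4, h5, h6⟩ := mem_goodWalks_props hm hν hσ h2 h3 hx.2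
    refine ⟨hl, ⟨h4, h5, fun i => ?_⟩, fun i hi => (h6 i hi).2⟩
    by_cases hi : i = Fin.last m
    · rw [hi, Fin.last_add_one, hl, (hσ _).1]
      exact (hν _).2.symm
    · exact (h6 i hi).1
  rw [← sum_sigma_fst _ (removingWalks G ν m), ← sum_sigma_fst _ (goodAddingWalks G ν m)]
  refine sum_le_sum_of_injOn (fun p => ⟨switch p.1 p.2, fun i => p.2 (-i)⟩) ?_ ?_ ?_ ?_
  · rintro ⟨σ, x⟩ hp
    rw [mem_sigma, mem_pmPerms] at hp
    obtain ⟨hσ, hx⟩ := hp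
    obtain ⟨hl, hx, h2⟩ := key σ hσ x hx
    simp only [mem_sigma, mem_pmPerms, removingWalks, mem_filter, mem_univ, true_and]
    refine ⟨hx.isPMPerm_switch hσ, ?_, fun i => hx.adj_switch_neg hσ i⟩
    rw [neg_zero, mem_agree]
    have := hx.switch_apply_add_one (Fin.last m)
    rw [Fin.last_add_one] at this
    rw [this, hl, (hσ _).1]
  · rintro ⟨σ, x⟩ - ⟨τ, y⟩ - h
    simp only [Sigma.mk.injEq, heq_eq_eq] at h
    have hxy : x = y := funext fun i => by simpa using congrFun h.2 (-i)
    subst hxy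
    rw [switch_right_injective h.1]
  · intro q _
    positivity
  · rintro ⟨σ, x⟩ hp
    rw [mem_sigma, mem_pmPerms] at hp
    obtain ⟨hσ, hx⟩ := hp
    obtain ⟨hl, hx, h2⟩ := key σ hσ x hx
    have h3 : #(agree ν (switch σ x)) ≤ #(agree ν σ) + 2 := card_agree_switch_le hν hσ hx h2
    exact pow_le_pow_of_le_one h0 h1
      (show #(agree ν (switch σ x)) - 1 ≤ #(agree ν σ) + 1 by omega)

theorem sum_card_mul_pow_le (hG : ∀ v, #{w | G.Adj v w} = d) (hm : 2 ≤ m) (hℓ : 0 ≤ ℓ)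
    (hν : IsPMPerm G ν)
    (hgood : ∀ σ a b, ℓ ≤ #(goodWalks G {1, σ, ν * σ, σ * ν} σ m a b))
    (hw : ∀ σ a b, (#(walks G σ m a b) : ℝ) ≤ u) (h0 : 0 ≤ t) (h1 : t ≤ 1) :
    ((d : ℝ) - 1) * ℓ * ∑ σ ∈ pmPerms G, #(agree ν σ) * t ^ (#(agree ν σ) - 1) ≤
      Fintype.card V * u * (t * ∑ σ ∈ pmPerms G, t ^ #(agree ν σ)) := by
  refine le_trans ?_ ((sum_removingCycles_le (m := m) hν h0 h1).trans ?_)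
  · rw [mul_sum]
    refine sum_le_sum fun σ hσ => ?_
    have := le_card_removingCycles hG hm hℓ hν (mem_pmPerms.1 hσ) (hgood σ)
    calc _ = #(agree ν σ) * (((d : ℝ) - 1) * ℓ) * t ^ (#(agree ν σ) - 1) := by ring
      _ ≤ _ := mul_le_mul_of_nonneg_right this (by positivity)
  · rw [mul_sum, mul_sum]
    refine sum_le_sum fun σ _ => ?_
    rw [pow_succ']
    exact mul_le_mul_of_nonneg_right (card_addingWalks_le (hw σ)) (by positivity)

theorem le_sum_card_mul_pow (hG : ∀ v, #{w | G.Adj v w} = d) (hm : 2 ≤ m) (hℓ : 0 ≤ ℓ)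
    (hν : IsPMPerm G ν)
    (hgood : ∀ σ a b, ℓ ≤ #(goodWalks G {1, σ, ν * σ, σ * ν} σ m a b))
    (hw : ∀ σ a b, (#(walks G σ m a b) : ℝ) ≤ u) (h0 : 0 ≤ t) (h1 : t ≤ 1) :
    Fintype.card V * ℓ * (t * ∑ σ ∈ pmPerms G, t ^ #(agree ν σ)) ≤
      (d * u + ℓ) * ∑ σ ∈ pmPerms G, #(agree ν σ) * t ^ (#(agree ν σ) - 1) := by
  have h2 := sum_goodAddingWalks_le (m := m) hm hν h0 h1
  have h3 : ∑ σ ∈ pmPerms G, ((Fintype.card V : ℝ) - #(agree ν σ)) * ℓ * t ^ (#(agree ν σ) + 1) ≤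
      ∑ σ ∈ pmPerms G, #(goodAddingWalks G ν m σ) * t ^ (#(agree ν σ) + 1) :=
    sum_le_sum fun σ _ => mul_le_mul_of_nonneg_right (le_card_goodAddingWalks (hgood σ))
      (by positivity)
  have h4 : ∑ σ ∈ pmPerms G, #(removingWalks G ν m σ) * t ^ (#(agree ν σ) - 1) ≤
      ∑ σ ∈ pmPerms G, #(agree ν σ) * (d * u) * t ^ (#(agree ν σ) - 1) :=
    sum_le_sum fun σ _ => mul_le_mul_of_nonneg_right (card_removingWalks_le hG (hw σ))
      (by positivity)
  have h5 : ∑ σ ∈ pmPerms G, (#(agree ν σ) : ℝ) * ℓ * t ^ (#(agree ν σ) + 1) ≤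
      ∑ σ ∈ pmPerms G, #(agree ν σ) * ℓ * t ^ (#(agree ν σ) - 1) :=
    sum_le_sum fun σ _ => mul_le_mul_of_nonneg_left
      (pow_le_pow_of_le_one h0 h1 (by omega)) (by positivity)
  have h6 : Fintype.card V * ℓ * (t * ∑ σ ∈ pmPerms G, t ^ #(agree ν σ)) =
      ∑ σ ∈ pmPerms G, ((Fintype.card V : ℝ) - #(agree ν σ)) * ℓ * t ^ (#(agree ν σ) + 1) +
      ∑ σ ∈ pmPerms G, (#(agree ν σ) : ℝ) * ℓ * t ^ (#(agree ν σ) + 1) := by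
    rw [← sum_add_distrib, mul_sum, mul_sum]
    exact sum_congr rfl fun σ _ => by ring
  have h7 : (d * u + ℓ) * ∑ σ ∈ pmPerms G, #(agree ν σ) * t ^ (#(agree ν σ) - 1) =
      ∑ σ ∈ pmPerms G, #(agree ν σ) * (d * u) * t ^ (#(agree ν σ) - 1) +
      ∑ σ ∈ pmPerms G, #(agree ν σ) * ℓ * t ^ (#(agree ν σ) - 1) := by
    rw [← sum_add_distrib, mul_sum]
    exact sum_congr rfl fun σ _ => by ring
  rw [h6, h7]
  linarith

end DoubleCounting

section Analysis

theorem le_mul_exp_of_deriv_le {f f' : ℝ → ℝ} {κ : ℝ} (hf : ∀ t, HasDerivAt f (f' t) t)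
    (h : ∀ t, 0 ≤ t → t ≤ 1 → f' t ≤ κ * (t * f t)) : f 1 ≤ f 0 * Real.exp (κ / 2) := by
  have hg : ∀ t, HasDerivAt (fun t => f t * Real.exp (-(κ / 2 * t ^ 2)))
      ((f' t - κ * (t * f t)) * Real.exp (-(κ / 2 * t ^ 2))) t := by
    intro t
    have h1 : HasDerivAt (fun t : ℝ => -(κ / 2 * t ^ 2)) (-(κ * t)) t :=
      ((hasDerivAt_pow 2 t).const_mul (κ / 2)).fun_neg.congr_deriv (by norm_num; ring)
    exact ((hf t).fun_mul h1.exp).congr_deriv (by ring)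
  have hanti : AntitoneOn (fun t => f t * Real.exp (-(κ / 2 * t ^ 2))) (Set.Icc 0 1) := by
    refine antitoneOn_of_deriv_nonpos (convex_Icc 0 1)
      (fun t _ => (hg t).continuousAt.continuousWithinAt)
      (fun t _ => (hg t).differentiableAt.differentiableWithinAt) fun t ht => ?_
    rw [interior_Icc] at ht
    rw [(hg t).deriv]
    exact mul_nonpos_of_nonpos_of_nonneg (by linarith [h t ht.1.le ht.2.le]) (Real.exp_pos _).le
  have h01 := hanti (Set.left_mem_Icc.2 zero_le_one) (Set.right_mem_Icc.2 zero_le_one) zero_le_one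
  simp only [one_pow, mul_one, ne_eq, OfNat.ofNat_ne_zero, not_false_eq_true, zero_pow, mul_zero,
    neg_zero, Real.exp_zero] at h01
  rwa [Real.exp_neg, ← div_eq_mul_inv, div_le_iff₀ (Real.exp_pos _)] at h01

variable {V : Type*} [Fintype V] [DecidableEq V] {G : SimpleGraph V} [DecidableRel G.Adj]
  {d m : ℕ} {ν : Equiv.Perm V} {ℓ u κ κ' : ℝ}

theorem hasDerivAt_sum_pow {ι : Type*} (s : Finset ι) (Y : ι → ℕ) (t : ℝ) :
    HasDerivAt (fun t : ℝ => ∑ i ∈ s, t ^ Y i) (∑ i ∈ s, Y i * t ^ (Y i - 1)) t :=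
  HasDerivAt.fun_sum fun i _ => hasDerivAt_pow (Y i) t

theorem card_pmPerms_le_and_le (hG : ∀ v, #{w | G.Adj v w} = d) (hm : 2 ≤ m) (hℓ : 0 < ℓ)
    (hd : 1 < d) (hu : 0 ≤ u) (hν : IsPMPerm G ν)
    (hgood : ∀ σ a b, ℓ ≤ #(goodWalks G {1, σ, ν * σ, σ * ν} σ m a b))
    (hw : ∀ σ a b, (#(walks G σ m a b) : ℝ) ≤ u)
    (hκ : Fintype.card V * u ≤ κ * (((d : ℝ) - 1) * ℓ))
    (hκ' : κ' * (d * u + ℓ) ≤ Fintype.card V * ℓ) :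
    #(pmPerms G) ≤ #{σ ∈ pmPerms G | agree ν σ = ∅} * Real.exp (κ / 2) ∧
      #{σ ∈ pmPerms G | agree ν σ = ∅} * Real.exp (κ' / 2) ≤ #(pmPerms G) := by
  have hder := hasDerivAt_sum_pow (pmPerms G) fun σ => #(agree ν σ)
  have hd' : (0 : ℝ) < (d : ℝ) - 1 := by
    rw [sub_pos]
    exact_mod_cast hd
  have e1 : ∑ σ ∈ pmPerms G, (1 : ℝ) ^ #(agree ν σ) = #(pmPerms G) := by simp
  have e0 : ∑ σ ∈ pmPerms G, (0 : ℝ) ^ #(agree ν σ) = #{σ ∈ pmPerms G | agree ν σ = ∅} := by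
    rw [card_filter, Nat.cast_sum]
    refine sum_congr rfl fun σ _ => ?_
    by_cases h : agree ν σ = ∅ <;> simp [h]
  have hZ : ∀ t : ℝ, 0 ≤ t → 0 ≤ t * ∑ σ ∈ pmPerms G, t ^ #(agree ν σ) := fun t ht => by positivity
  have hZ' : ∀ t : ℝ, 0 ≤ t → 0 ≤ ∑ σ ∈ pmPerms G, #(agree ν σ) * t ^ (#(agree ν σ) - 1) :=
    fun t ht => by positivity
  rw [← e1, ← e0]
  constructor
  · refine le_mul_exp_of_deriv_le hder fun t h0 h1 => ?_
    have h2 := sum_card_mul_pow_le hG hm hℓ.le hν hgood hw h0 h1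
    have h3 := mul_le_mul_of_nonneg_right hκ (hZ t h0)
    have h4 : 0 < ((d : ℝ) - 1) * ℓ := mul_pos hd' hℓ
    refine le_of_mul_le_mul_left ?_ h4
    linarith
  · have h := le_mul_exp_of_deriv_le (κ := κ') (fun t => (hder t).neg) fun t h0 h1 => ?_
    · simp only [Pi.neg_apply] at h
      linarith
    have h2 := le_sum_card_mul_pow hG hm hℓ.le hν hgood hw h0 h1
    have h3 := mul_le_mul_of_nonneg_right hκ' (hZ t h0)
    have h4 : 0 < d * u + ℓ := by positivity
    refine le_of_mul_le_mul_left ?_ h4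
    simp only [Pi.neg_apply]
    linarith

end Analysis

section Counting

variable {V : Type*} [Fintype V] [DecidableEq V] {G : SimpleGraph V} [DecidableRel G.Adj]
  {d m : ℕ}

theorem card_walks_bounds (hG : ∀ v, #{w | G.Adj v w} = d) {ρ δ : ℝ}
    (hd : d ≤ Fintype.card V) (hd2 : Fintype.card V ≤ 2 * d) (h0 : 0 < d)
    (hρ : (Fintype.card V : ℝ) - d ≤ ρ * d) (hm : 2 ≤ m) (hδ : 2 * ρ ^ (m - 1) ≤ δ)
    (hn : 4 * (m + 1) ^ 2 * 2 ^ m ≤ δ * Fintype.card V) (ν σ : Equiv.Perm V) (a b : V) :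
    (#(walks G σ m a b) : ℝ) ≤ (1 + δ) * ((d : ℝ) ^ m / Fintype.card V) ∧
      (1 - 2 * δ) * ((d : ℝ) ^ m / Fintype.card V) ≤
        #(goodWalks G {1, σ, ν * σ, σ * ν} σ m a b) := by
  obtain ⟨k, rfl⟩ : ∃ k, m = k + 2 := ⟨m - 2, by omega⟩
  simp only [Nat.add_succ_sub_one] at hδ
  set n := (Fintype.card V : ℝ) with hn_def
  have hd0 : (0 : ℝ) < d := by exact_mod_cast h0
  have hdn : (d : ℝ) ≤ n := by rw [hn_def]; exact_mod_cast hd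
  have hd2' : n ≤ 2 * d := by rw [hn_def]; exact_mod_cast hd2
  have hn0 : 0 < n := hd0.trans_le hdn
  have h1 := abs_walkCount_sub_le hG hd σ (k + 1) a b
  rw [← card_walks, ← hn_def, show k + 1 + 1 = k + 2 from rfl] at h1
  have h2 : (n - d) ^ (k + 1) ≤ δ * ((d : ℝ) ^ (k + 2) / n) := by
    calc (n - d) ^ (k + 1) ≤ (ρ * d) ^ (k + 1) := pow_le_pow_left₀ (by linarith) hρ _
      _ = ρ ^ (k + 1) * d ^ (k + 1) := mul_pow _ _ _
      _ ≤ δ / 2 * d ^ (k + 1) :=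
        mul_le_mul_of_nonneg_right (by linarith) (by positivity)
      _ ≤ δ * ((d : ℝ) ^ (k + 2) / n) := by
        have hδ0 : 0 ≤ δ := by
          have : (0 : ℝ) ≤ 4 * (((k + 2 : ℕ) : ℝ) + 1) ^ 2 * 2 ^ (k + 2) := by positivity
          exact nonneg_of_mul_nonneg_left (this.trans hn) hn0
        rw [mul_div_assoc', le_div_iff₀ hn0, pow_succ _ (k + 1)]
        have : 0 ≤ δ / 2 * (d : ℝ) ^ (k + 1) := by positivity
        nlinarith
  have h3 := abs_le.1 (h1.trans h2)
  refine ⟨by linarith [h3.2], ?_⟩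
  have h4 := card_walks_le_card_goodWalks_add (G := G) {1, σ, ν * σ, σ * ν} σ
    (show k + 2 ≠ 0 by omega) a b
  have h5 : #({1, σ, ν * σ, σ * ν} : Finset (Equiv.Perm V)) ≤ 4 := card_le_four
  have h6 : (#(walks G σ (k + 2) a b) : ℝ) ≤
      #(goodWalks G {1, σ, ν * σ, σ * ν} σ (k + 2) a b) +
        (((k + 2 : ℕ) : ℝ) + 1) ^ 2 * 4 * n ^ k := by
    have h7 := h4.trans (Nat.add_le_add_left (Nat.mul_le_mul_right _ (Nat.mul_le_mul_left _ h5)) _)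
    rw [Nat.add_sub_cancel] at h7
    rw [hn_def]
    exact_mod_cast h7
  have h8 : (((k + 2 : ℕ) : ℝ) + 1) ^ 2 * 4 * n ^ k ≤ δ * ((d : ℝ) ^ (k + 2) / n) := by
    rw [mul_div_assoc', le_div_iff₀ hn0]
    refine le_of_mul_le_mul_right ?_ hn0
    calc (((k + 2 : ℕ) : ℝ) + 1) ^ 2 * 4 * n ^ k * n * n
        = 4 * (((k + 2 : ℕ) : ℝ) + 1) ^ 2 * n ^ (k + 2) := by ring
      _ ≤ 4 * (((k + 2 : ℕ) : ℝ) + 1) ^ 2 * (2 * d) ^ (k + 2) :=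
        mul_le_mul_of_nonneg_left (pow_le_pow_left₀ hn0.le hd2' _) (by positivity)
      _ = 4 * (((k + 2 : ℕ) : ℝ) + 1) ^ 2 * 2 ^ (k + 2) * d ^ (k + 2) := by rw [mul_pow]; ring
      _ ≤ δ * n * d ^ (k + 2) := mul_le_mul_of_nonneg_right hn (by positivity)
      _ = _ := by ring
  linarith [h3.1]

/-- For every `θ > 0`, a uniformly random perfect matching of a large dense regular graph avoids
a given perfect matching with probability between `exp (-(1 + θ) n / (2 d))` and
`exp (-(1 - θ) n / (2 d))`. -/
theorem exists_card_pmPerms_bounds {α θ : ℝ} (hα : 1 / 2 < α) (hα1 : α ≤ 1) (hθ : 0 < θ)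
    (hθ1 : θ ≤ 1) : ∃ n₀ : ℕ, ∀ (V : Type) [Fintype V] [DecidableEq V] (G : SimpleGraph V)
      [DecidableRel G.Adj] (d : ℕ) (ν : Equiv.Perm V), n₀ ≤ Fintype.card V →
      α * Fintype.card V ≤ d → (∀ v, #{w | G.Adj v w} = d) → IsPMPerm G ν →
      #(pmPerms G) ≤ #{σ ∈ pmPerms G | agree ν σ = ∅} *
          Real.exp ((1 + θ) * (Fintype.card V / d) / 2) ∧
        #{σ ∈ pmPerms G | agree ν σ = ∅} *
          Real.exp ((1 - θ) * (Fintype.card V / d) / 2) ≤ #(pmPerms G) := by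
  have hρ0 : 0 ≤ α⁻¹ - 1 := by
    rw [sub_nonneg]
    exact (one_le_inv₀ (by linarith)).2 hα1
  have hρ1 : α⁻¹ - 1 < 1 := by
    have : α⁻¹ < 2 := by
      rw [inv_lt_comm₀ (by linarith) two_pos]
      linarith
    linarith
  set δ := θ / 8 with hδ_def
  have hδ0 : 0 < δ := by positivity
  obtain ⟨k, hk⟩ := exists_pow_lt_of_lt_one (half_pos hδ0) hρ1
  obtain ⟨n₀, hn₀⟩ := exists_nat_ge ((4 * (((k + 2 : ℕ) : ℝ) + 1) ^ 2 * 2 ^ (k + 2) + 4) / δ)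
  refine ⟨n₀, fun V _ _ G _ d ν hn hdn hG hν => ?_⟩
  set n := (Fintype.card V : ℝ) with hn_def
  have hnδ : 4 * (((k + 2 : ℕ) : ℝ) + 1) ^ 2 * 2 ^ (k + 2) + 4 ≤ δ * n := by
    rw [div_le_iff₀ hδ0] at hn₀
    have : (n₀ : ℝ) ≤ n := by rw [hn_def]; exact_mod_cast hn
    nlinarith
  have hC : (0 : ℝ) ≤ 4 * (((k + 2 : ℕ) : ℝ) + 1) ^ 2 * 2 ^ (k + 2) := by positivity
  have hn0 : 0 < n := by
    by_contra h
    nlinarith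
  have hd2 : n ≤ 2 * d := by nlinarith
  have hδd : 2 ≤ δ * d := by nlinarith
  have hd1 : (1 : ℝ) < d := by
    have : δ ≤ 1 := by linarith
    nlinarith
  have hdV : d ≤ Fintype.card V := by
    obtain ⟨v⟩ : Nonempty V := Fintype.card_pos_iff.1 (by rw [hn_def] at hn0; exact_mod_cast hn0)
    rw [← hG v]
    exact card_le_univ _
  have hdn' : (d : ℝ) ≤ n := by rw [hn_def]; exact_mod_cast hdV
  have hρ : n - d ≤ (α⁻¹ - 1) * d := by
    have : n ≤ α⁻¹ * d := by
      rw [inv_mul_eq_div, le_div_iff₀ (by linarith)]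
      linarith
    linarith
  have hb := card_walks_bounds (m := k + 2) (δ := δ) hG hdV (by rw [hn_def] at hd2; exact_mod_cast hd2)
    (by exact_mod_cast zero_lt_one.trans hd1) hρ (by omega)
    (by
      rw [show k + 2 - 1 = k + 1 from rfl, pow_succ]
      have : (α⁻¹ - 1) ^ k * (α⁻¹ - 1) ≤ (α⁻¹ - 1) ^ k :=
        mul_le_of_le_one_right (pow_nonneg hρ0 k) hρ1.le
      linarith) (by linarith) ν
  have hq : 0 < (d : ℝ) ^ (k + 2) / n := by positivity
  have hδθ : θ = 8 * δ := by rw [hδ_def]; ring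
  refine card_pmPerms_le_and_le (ℓ := (1 - 2 * δ) * ((d : ℝ) ^ (k + 2) / n))
    (u := (1 + δ) * ((d : ℝ) ^ (k + 2) / n)) hG (show 2 ≤ k + 2 by omega)
    (mul_pos (by linarith) hq) (by exact_mod_cast hd1) (by positivity) hν
    (fun σ a b => (hb σ a b).2) (fun σ a b => (hb σ a b).1) ?_ ?_
  · rw [← hn_def, show (1 + θ) * (n / d) * (((d : ℝ) - 1) * ((1 - 2 * δ) *
      ((d : ℝ) ^ (k + 2) / n))) = n * ((1 + θ) * (1 - 2 * δ) * (((d : ℝ) - 1) / d) *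
      ((d : ℝ) ^ (k + 2) / n)) by ring]
    refine mul_le_mul_of_nonneg_left (mul_le_mul_of_nonneg_right ?_ hq.le) hn0.le
    have h1 : 1 - δ ≤ ((d : ℝ) - 1) / d := by
      rw [le_div_iff₀ (by linarith)]
      linarith
    have h2 : 0 ≤ (1 + θ) * (1 - 2 * δ) := mul_nonneg (by linarith) (by linarith)
    refine le_trans ?_ (mul_le_mul_of_nonneg_left h1 h2)
    rw [hδθ]
    have h3 : δ ≤ 1 / 8 := by linarith
    nlinarith [mul_nonneg hδ0.le (sub_nonneg.2 h3), mul_nonneg (sq_nonneg δ) hδ0.le]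
  · rw [← hn_def, show (1 - θ) * (n / d) * (d * ((1 + δ) * ((d : ℝ) ^ (k + 2) / n)) +
      (1 - 2 * δ) * ((d : ℝ) ^ (k + 2) / n)) = n * ((1 - θ) * ((1 + δ) * (d / d) +
      (1 - 2 * δ) * (1 / d)) * ((d : ℝ) ^ (k + 2) / n)) by ring, div_self (by linarith)]
    refine mul_le_mul_of_nonneg_left (mul_le_mul_of_nonneg_right ?_ hq.le) hn0.le
    have h1 : 1 / (d : ℝ) ≤ δ := by
      rw [div_le_iff₀ (by linarith)]
      linarith
    have h2 : (1 - 2 * δ) * (1 / (d : ℝ)) ≤ δ := by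
      have : 0 < 1 / (d : ℝ) := by positivity
      nlinarith
    refine (mul_le_mul_of_nonneg_left (add_le_add_right h2 _) (by linarith)).trans ?_
    rw [hδθ]
    nlinarith

end Counting

section Translation

variable {V : Type*} [Fintype V] [DecidableEq V] {G : SimpleGraph V}

omit [Fintype V] [DecidableEq V] in
theorem IsPM.exists_perm {M : Finset (Sym2 V)} (hM : IsPM G M) :
    ∃ σ : Equiv.Perm V, IsPMPerm G σ ∧ ∀ v w, s(v, w) ∈ M ↔ w = σ v := by
  have h : ∀ v, ∃ w, s(v, w) ∈ M ∧ ∀ w', s(v, w') ∈ M → w' = w := by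
    intro v
    obtain ⟨e, ⟨he, hv⟩, hu⟩ := hM.2 v
    obtain ⟨w, rfl⟩ := Sym2.mem_iff_exists.1 hv
    exact ⟨w, he, fun w' hw' => Sym2.congr_right.1 (hu _ ⟨hw', Sym2.mem_mk_left v w'⟩)⟩
  choose f hf hf' using h
  have hinv : Function.Involutive f := fun v => (hf' (f v) v (by rw [Sym2.eq_swap]; exact hf v)).symm
  refine ⟨hinv.toPerm, fun v => ⟨hinv v, hM.1 _ (hf v)⟩, fun v w => ⟨hf' v w, ?_⟩⟩
  rintro rfl
  exact hf v

/-- The edge set of the perfect matching given by an involution. -/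
def permEdges (σ : Equiv.Perm V) : Finset (Sym2 V) := univ.image fun v => s(v, σ v)

theorem mk_mem_permEdges {σ : Equiv.Perm V} (hσ : IsPMPerm G σ) {v w : V} :
    s(v, w) ∈ permEdges σ ↔ w = σ v := by
  simp only [permEdges, mem_image, mem_univ, true_and, Sym2.eq_iff]
  constructor
  · rintro ⟨u, ⟨rfl, rfl⟩ | ⟨rfl, rfl⟩⟩
    · rfl
    · exact (hσ _).1.symm
  · rintro rfl
    exact ⟨v, Or.inl ⟨rfl, rfl⟩⟩

theorem IsPMPerm.isPM {σ : Equiv.Perm V} (hσ : IsPMPerm G σ) : IsPM G (permEdges σ) := by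
  constructor
  · intro e he
    obtain ⟨v, -, rfl⟩ := mem_image.1 he
    exact (hσ v).2
  · intro v
    refine ⟨s(v, σ v), ⟨(mk_mem_permEdges hσ).2 rfl, Sym2.mem_mk_left _ _⟩, ?_⟩
    rintro e ⟨he, hv⟩
    obtain ⟨w, rfl⟩ := Sym2.mem_iff_exists.1 hv
    rw [(mk_mem_permEdges hσ).1 he]

theorem pmCount_eq_card_pmPerms (G : SimpleGraph V) : pmCount G = #(pmPerms G) := by
  have h : Function.Bijective fun σ : {σ : Equiv.Perm V // IsPMPerm G σ} =>
      (⟨permEdges σ.1, σ.2.isPM⟩ : {M : Finset (Sym2 V) // IsPM G M}) := by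
    constructor
    · rintro ⟨σ, hσ⟩ ⟨τ, hτ⟩ h
      have h' : permEdges σ = permEdges τ := congrArg Subtype.val h
      refine Subtype.ext (Equiv.ext fun v => ?_)
      rw [← mk_mem_permEdges hτ, ← h', mk_mem_permEdges hσ]
    · rintro ⟨M, hM⟩
      obtain ⟨σ, hσ, h⟩ := hM.exists_perm
      refine ⟨⟨σ, hσ⟩, Subtype.ext ?_⟩
      ext e
      induction e with
      | _ v w => rw [mk_mem_permEdges hσ, h]
  rw [pmCount, ← Nat.card_congr (Equiv.ofBijective _ h)]
  exact Nat.subtype_card _ fun _ => mem_pmPerms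

theorem pmPerms_deleteEdges {N : Finset (Sym2 V)} {ν : Equiv.Perm V}
    (hN : ∀ v w, s(v, w) ∈ N ↔ w = ν v) :
    pmPerms (G.deleteEdges (N : Set (Sym2 V))) = {σ ∈ pmPerms G | agree ν σ = ∅} := by
  ext σ
  simp only [mem_pmPerms, mem_filter, mem_univ, IsPMPerm, SimpleGraph.deleteEdges_adj,
    mem_coe, hN, agree, filter_eq_empty_iff, forall_true_left]
  exact ⟨fun h => ⟨fun v => ⟨(h v).1, (h v).2.1⟩, fun v => (h v).2.2⟩,
    fun h v => ⟨(h.1 v).1, (h.1 v).2, @h.2 v⟩⟩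

end Translation

theorem div_bounds_of_exp_bounds {P Q L θ ε : ℝ} (hP : 0 < P) (hQ : 0 ≤ Q) (hL : L ≤ 1)
    (hθ : 0 ≤ θ) (hθε : θ ≤ Real.log (1 + ε)) (hε : 0 < ε)
    (h1 : P ≤ Q * Real.exp ((1 + θ) * L)) (h2 : Q * Real.exp ((1 - θ) * L) ≤ P) :
    (1 - ε) * Real.exp (-L) ≤ Q / P ∧ Q / P ≤ (1 + ε) * Real.exp (-L) := by
  have hθL : θ * L ≤ θ := mul_le_of_le_one_right hθ hL
  have hlog : Real.log (1 + ε) ≤ ε := by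
    linarith [Real.log_le_sub_one_of_pos (show (0 : ℝ) < 1 + ε by linarith)]
  constructor
  · rw [le_div_iff₀ hP]
    have h3 : 1 - ε ≤ Real.exp (-(θ * L)) := by linarith [Real.add_one_le_exp (-(θ * L))]
    calc (1 - ε) * Real.exp (-L) * P ≤ Real.exp (-(θ * L)) * Real.exp (-L) * P := by gcongr
      _ ≤ Real.exp (-(θ * L)) * Real.exp (-L) * (Q * Real.exp ((1 + θ) * L)) := by gcongr
      _ = Q * Real.exp (-(θ * L) + -L + (1 + θ) * L) := by
        rw [Real.exp_add, Real.exp_add]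
        ring
      _ = Q := by
        rw [show -(θ * L) + -L + (1 + θ) * L = 0 by ring, Real.exp_zero, mul_one]
  · rw [div_le_iff₀ hP]
    have h3 : Real.exp (θ * L) ≤ 1 + ε := by
      rw [← Real.le_log_iff_exp_le (by linarith)]
      linarith
    calc Q = Q * Real.exp (θ * L + -L + (1 - θ) * L) := by
          rw [show θ * L + -L + (1 - θ) * L = 0 by ring, Real.exp_zero, mul_one]
      _ = Real.exp (θ * L) * Real.exp (-L) * (Q * Real.exp ((1 - θ) * L)) := by
        rw [Real.exp_add, Real.exp_add]
        ring
      _ ≤ (1 + ε) * Real.exp (-L) * P := by gcongr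

/-- For `α > 1/2`, every `d`-regular graph `G` on a large even number
`n` of vertices with `d ≥ αn` and any perfect matching `N` of `G` satisfy
`pm(G - N)/pm(G) = (1 ± ε) e^{-n/(2d)}`. -/
theorem pm_ratio_dense_regular :
    ∀ α : ℝ, 1 / 2 < α →
    ∀ ε : ℝ, 0 < ε →
    ∃ n₀ : ℕ, ∀ n : ℕ, n₀ ≤ n → Even n →
    ∀ d : ℕ, α * (n : ℝ) ≤ (d : ℝ) →
    ∀ (V : Type) [Fintype V], Fintype.card V = n →
    ∀ G : SimpleGraph V, RegularDeg G d →
    ∀ N : Finset (Sym2 V), IsPM G N →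
      0 < pmCount G ∧
      (1 - ε) * Real.exp (-(n : ℝ) / (2 * (d : ℝ))) ≤
        (pmCount (G.deleteEdges (↑N : Set (Sym2 V))) : ℝ) / (pmCount G : ℝ) ∧
      (pmCount (G.deleteEdges (↑N : Set (Sym2 V))) : ℝ) / (pmCount G : ℝ) ≤
        (1 + ε) * Real.exp (-(n : ℝ) / (2 * (d : ℝ))) := by
  classical
  intro α hα ε hε
  have hlog : 0 < Real.log (1 + ε) := Real.log_pos (by linarith)
  obtain ⟨n₀, hn₀⟩ := exists_card_pmPerms_bounds (α := min α 1) (θ := min 1 (Real.log (1 + ε)))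
    (lt_min hα (by norm_num)) (min_le_right _ _) (lt_min one_pos hlog) (min_le_left _ _)
  refine ⟨max n₀ 1, fun n hn _ d hd V _ hV G hG N hN => ?_⟩
  subst hV
  have hn1 : (0 : ℝ) < Fintype.card V := by exact_mod_cast (le_max_right _ _).trans hn
  have hG' : ∀ v, #{u | G.Adj v u} = d := by
    intro v
    rw [← hG v, Nat.card_eq_fintype_card, Fintype.card_subtype]
    rfl
  obtain ⟨ν, hν, hNν⟩ := hN.exists_perm
  obtain ⟨h1, h2⟩ := hn₀ V G d ν ((le_max_left _ _).trans hn)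
    ((mul_le_mul_of_nonneg_right (min_le_left _ _) hn1.le).trans hd) hG' hν
  have hpos : 0 < pmCount G := by
    rw [pmCount_eq_card_pmPerms, card_pos]
    exact ⟨ν, mem_pmPerms.2 hν⟩
  have hd0 : (0 : ℝ) < d := lt_of_lt_of_le (mul_pos (by linarith) hn1) hd
  have hL : (Fintype.card V / d : ℝ) / 2 ≤ 1 := by
    rw [div_le_one two_pos, div_le_iff₀ hd0]
    nlinarith
  refine ⟨hpos, ?_⟩
  rw [← pmPerms_deleteEdges hNν, ← pmCount_eq_card_pmPerms, ← pmCount_eq_card_pmPerms,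
    mul_div_assoc] at h1 h2
  rw [show -(Fintype.card V : ℝ) / (2 * d) = -((Fintype.card V / d : ℝ) / 2) by
    rw [div_div, neg_div, mul_comm]]
  exact div_bounds_of_exp_bounds (by exact_mod_cast hpos) (Nat.cast_nonneg _) hL
    (lt_min one_pos hlog).le (min_le_right _ _) hε h1 h2

end RPM
end
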